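/- arXiv:1503.05812 — 10 statements merged into one kernel-verified Lean document; each statement's English description precedes it below -/
import Mathlib

section
/- Let d ≥ 2 and k ≥ 1 be integers, λ > 0 a real, and let x̂ > 0 be the unique positive solution of x̂ = kλ/(1+x̂)^d. Then d·x̂/(1+x̂) ≤ 1 if and only if λ ≤ d^d/(k(d−1)^{d+1}); moreover d·x̂/(1+x̂) < 1 if λ < d^d/(k(d−1)^{d+1}). (Here d·x̂/(1+x̂) equals |f'_{d,k}(x̂)|, the absolute value of the derivative of f_{d,k} at the fixed point.) -/
theorem strictMonoOn_mul_one_add_pow (d : ℕ) :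
    StrictMonoOn (fun x : ℝ => x * (1 + x) ^ d) (Set.Ici 0) := by
  intro x hx y hy hxy
  have hx0 : (0 : ℝ) ≤ x := hx
  have hpow : (1 + x) ^ d ≤ (1 + y) ^ d := by gcongr
  exact mul_lt_mul hxy hpow (by positivity) hy

theorem inv_mul_one_add_inv_pow (d : ℕ) {a : ℝ} (ha : 0 < a) :
    a⁻¹ * (1 + a⁻¹) ^ d = (a + 1) ^ d / a ^ (d + 1) := by
  have h : 1 + a⁻¹ = (a + 1) / a := by field_simp
  rw [h, div_pow, pow_succ]
  field_simp

/-- For `d ≥ 2`, `k ≥ 1`, `λ > 0` and `x̂ > 0` the unique positive solution of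
`x̂ = kλ/(1+x̂)^d`, we have `d·x̂/(1+x̂) ≤ 1 ↔ λ ≤ d^d/(k(d−1)^(d+1))`, and moreover
`d·x̂/(1+x̂) < 1` if `λ < d^d/(k(d−1)^(d+1))`. -/
theorem stmt1 (d k : ℕ) (hd : 2 ≤ d) (hk : 1 ≤ k) (lam : ℝ) (hlam : 0 < lam)
    (xhat : ℝ) (hx : 0 < xhat) (hfix : xhat = (k : ℝ) * lam / (1 + xhat) ^ d) :
    ((d : ℝ) * xhat / (1 + xhat) ≤ 1 ↔
      lam ≤ (d : ℝ) ^ d / ((k : ℝ) * ((d : ℝ) - 1) ^ (d + 1))) ∧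
    (lam < (d : ℝ) ^ d / ((k : ℝ) * ((d : ℝ) - 1) ^ (d + 1)) →
      (d : ℝ) * xhat / (1 + xhat) < 1) := by
  have hk0 : (0 : ℝ) < k := by exact_mod_cast hk
  have hd0 : (0 : ℝ) < (d : ℝ) - 1 := by
    have : (2 : ℝ) ≤ d := by exact_mod_cast hd
    linarith
  have hfix' : xhat * (1 + xhat) ^ d = k * lam :=
    (eq_div_iff (by positivity)).mp hfix
  have hcrit : ((d : ℝ) - 1)⁻¹ * (1 + ((d : ℝ) - 1)⁻¹) ^ d
      = (d : ℝ) ^ d / ((d : ℝ) - 1) ^ (d + 1) := by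
    simpa using inv_mul_one_add_inv_pow d hd0
  have hcrit' : (d : ℝ) ^ d / ((k : ℝ) * ((d : ℝ) - 1) ^ (d + 1))
      = (d : ℝ) ^ d / ((d : ℝ) - 1) ^ (d + 1) / k := by
    rw [div_div, mul_comm]
  have hmono := strictMonoOn_mul_one_add_pow d
  have hxmem : xhat ∈ Set.Ici (0 : ℝ) := hx.le
  have hcmem : ((d : ℝ) - 1)⁻¹ ∈ Set.Ici (0 : ℝ) := (inv_pos.mpr hd0).le
  have hle := hmono.le_iff_le hxmem hcmem
  have hlt := hmono.lt_iff_lt hxmem hcmem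
  simp only [hfix', hcrit] at hle hlt
  rw [hcrit', le_div_iff₀' hk0, lt_div_iff₀' hk0, hle, hlt, div_le_one (by positivity),
    div_lt_one (by positivity), le_inv_comm₀ hx hd0, lt_inv_comm₀ hx hd0,
    ← one_div, le_div_iff₀ hx, lt_div_iff₀ hx]
  exact ⟨⟨fun h => by linarith, fun h => by linarith⟩, fun h => by linarith⟩
end

section
/- Let d ≥ 2 and k ≥ 1 be integers and 0 < λ ≤ λ_c = d^d/(k(d−1)^{d+1}). Let x̂ > 0 be the unique positive fixed point of f(x) = kλ/(1+x)^d and let g = f ∘ f, i.e. g(x) = kλ(1 + kλ/(1+x)^d)^{−d}. Then for every real x > x̂, g(x) − g(x̂) ≤ (d·x̂/(1+x̂))^2 · (x − x̂). -/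
/-- The map `t ↦ K / (1 + t) ^ d` has derivative `-d · (K / (1 + t) ^ d) / (1 + t)`. -/
theorem hasDerivAt_div_one_add_pow (K : ℝ) (d : ℕ) {t : ℝ} (ht : 0 < 1 + t) :
    HasDerivAt (fun s : ℝ => K / (1 + s) ^ d) (-((d : ℝ) * (K / (1 + t) ^ d) / (1 + t))) t := by
  have h := (hasDerivAt_const t K).fun_div (((hasDerivAt_id' t).const_add 1).fun_pow d)
    (pow_pos ht d).ne'
  refine h.congr_deriv ?_
  rcases d with _ | n
  · simp
  · simp only [Nat.add_sub_cancel]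
    field_simp
    ring

/-- If `a (1 + a) ^ d` is at most its value at `a = 1 / (d - 1)`, then `d a ≤ 1 + a`. -/
theorem mul_le_one_add_of_mul_pow_le {d : ℕ} (hd : 2 ≤ d) {a : ℝ}
    (h : a * (1 + a) ^ d ≤ (d : ℝ) ^ d / ((d : ℝ) - 1) ^ (d + 1)) : (d : ℝ) * a ≤ 1 + a := by
  have hd1 : (0 : ℝ) < (d : ℝ) - 1 := by
    have : (2 : ℝ) ≤ d := by exact_mod_cast hd
    linarith
  by_contra! hlt
  have h1 : 1 < a * ((d : ℝ) - 1) := by linarith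
  have h2 : (d : ℝ) ^ d ≤ ((1 + a) * ((d : ℝ) - 1)) ^ d :=
    pow_le_pow_left₀ (by positivity) (by linarith) d
  have h3 : (0 : ℝ) < (d : ℝ) ^ d := pow_pos (by linarith) d
  rw [le_div_iff₀ (pow_pos hd1 _)] at h
  have h4 : a * (1 + a) ^ d * ((d : ℝ) - 1) ^ (d + 1)
      = a * ((d : ℝ) - 1) * ((1 + a) * ((d : ℝ) - 1)) ^ d := by
    rw [mul_pow]
    ring
  nlinarith

/-- If `d a ≤ 1 + a` and `a ≤ t`, then `(1 + a)² ≤ (1 + f t) (1 + t)` for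
`f t = a (1 + a) ^ d / (1 + t) ^ d`. -/
theorem one_add_sq_le_of_mul_le {d : ℕ} {a t : ℝ} (ha : 0 < a) (hda : (d : ℝ) * a ≤ 1 + a)
    (hat : a ≤ t) :
    (1 + a) ^ 2 ≤ (1 + a * (1 + a) ^ d / (1 + t) ^ d) * (1 + t) := by
  have ht : 0 < 1 + t := by linarith
  set r := (1 + a) / (1 + t) with hr
  have hr0 : 0 < r := by positivity
  have hr1 : r ≤ 1 := (div_le_one ht).2 (by linarith)
  have hrt : r * (1 + t) = 1 + a := div_mul_cancel₀ _ ht.ne'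
  have hb : 1 + (d : ℝ) * (r - 1) ≤ r ^ d := by
    simpa using one_add_mul_le_pow (show (-2 : ℝ) ≤ r - 1 by linarith) d
  have hy : a * (1 + a) ^ d / (1 + t) ^ d = a * r ^ d := by
    rw [hr, div_pow, mul_div_assoc]
  have hle : (1 + a) * r ≤ 1 + a * r ^ d := by
    nlinarith [mul_le_mul_of_nonneg_left hb ha.le,
      mul_nonneg (sub_nonneg.2 hda) (sub_nonneg.2 hr1)]
  calc (1 + a) ^ 2 = (1 + a) * r * (1 + t) := by rw [mul_assoc, hrt, sq]
    _ ≤ _ := by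
      rw [hy]
      exact mul_le_mul_of_nonneg_right hle ht.le


/-- For `d ≥ 2`, `k ≥ 1`, `0 < λ ≤ λ_c = d^d/(k(d−1)^(d+1))`, with `x̂` the unique
positive fixed point of `f(x) = kλ/(1+x)^d` and `g = f ∘ f`, for every `x > x̂` we have
`g(x) − g(x̂) ≤ (d·x̂/(1+x̂))² · (x − x̂)`. -/
theorem stmt3 (d k : ℕ) (hd : 2 ≤ d) (hk : 1 ≤ k) (lam : ℝ) (hlam : 0 < lam)
    (hle : lam ≤ (d : ℝ) ^ d / ((k : ℝ) * ((d : ℝ) - 1) ^ (d + 1)))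
    (xhat : ℝ) (hx : 0 < xhat) (hfix : xhat = (k : ℝ) * lam / (1 + xhat) ^ d)
    (g : ℝ → ℝ)
    (hg : ∀ x : ℝ, g x = (k : ℝ) * lam / (1 + (k : ℝ) * lam / (1 + x) ^ d) ^ d) :
    ∀ x : ℝ, xhat < x →
      g x - g xhat ≤ ((d : ℝ) * xhat / (1 + xhat)) ^ 2 * (x - xhat) := by
  intro x hax
  set K : ℝ := (k : ℝ) * lam with hK
  have hk0 : (0 : ℝ) < k := by exact_mod_cast hk
  have hK0 : 0 < K := mul_pos hk0 hlam
  have hKa : xhat * (1 + xhat) ^ d = K := (eq_div_iff (by positivity)).1 hfix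
  have hd1 : (0 : ℝ) < (d : ℝ) - 1 := by
    have : (2 : ℝ) ≤ d := by exact_mod_cast hd
    linarith
  have hda : (d : ℝ) * xhat ≤ 1 + xhat := by
    refine mul_le_one_add_of_mul_pow_le hd ?_
    rw [le_div_iff₀ (by positivity)] at hle
    rw [hKa, hK, le_div_iff₀ (by positivity)]
    linarith
  have hderiv : ∀ t, xhat ≤ t → HasDerivAt g
      ((d : ℝ) ^ 2 * (K ^ 2 / ((1 + K / (1 + t) ^ d) * (1 + t)) ^ (d + 1))) t := by
    intro t hat
    have ht : 0 < 1 + t := by linarith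
    have hy : 0 < 1 + K / (1 + t) ^ d := by positivity
    rw [funext hg]
    refine ((hasDerivAt_div_one_add_pow K d hy).comp t
      (hasDerivAt_div_one_add_pow K d ht)).congr_deriv ?_
    generalize 1 + K / (1 + t) ^ d = y at hy ⊢
    rw [mul_pow y]
    field_simp
    ring
  refine (convex_Ici xhat).image_sub_le_mul_sub_of_deriv_le
    (fun t ht => (hderiv t ht).continuousAt.continuousWithinAt)
    (fun t ht => (hderiv t (interior_subset ht)).differentiableAt.differentiableWithinAt)
    (fun t ht => ?_) xhat Set.self_mem_Ici x hax.le hax.le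
  have hat : xhat ≤ t := interior_subset ht
  rw [(hderiv t hat).deriv]
  have hsq := one_add_sq_le_of_mul_le hx hda hat
  rw [hKa] at hsq
  calc (d : ℝ) ^ 2 * (K ^ 2 / ((1 + K / (1 + t) ^ d) * (1 + t)) ^ (d + 1))
      ≤ (d : ℝ) ^ 2 * (K ^ 2 / ((1 + xhat) ^ 2) ^ (d + 1)) := by gcongr
    _ = ((d : ℝ) * xhat / (1 + xhat)) ^ 2 := by
      rw [← hKa]
      have hb : 0 < 1 + xhat := by linarith
      generalize 1 + xhat = b at hb ⊢
      field_simp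
      ring
end

section
/- Let d ≥ 2 and k ≥ 1 be integers and 0 < λ ≤ λ_c = d^d/(k(d−1)^{d+1}). Let x̂ be the unique positive fixed point of f(x) = kλ/(1+x)^d and g = f ∘ f. Then g'(x̂) = (d·x̂/(1+x̂))^2, the derivative g' is nonincreasing on [x̂, ∞), and hence g'(z) ≤ (d·x̂/(1+x̂))^2 ≤ 1 for every z ≥ x̂. -/
/-- The derivative of `x ↦ c / (1 + c / (1 + x) ^ d) ^ d` at a point `x > -1`. -/
theorem hasDerivAt_div_one_add_pow_comp_self (d : ℕ) {c x : ℝ} (hc : 0 < c) (hx : -1 < x) :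
    HasDerivAt (fun x : ℝ => c / (1 + c / (1 + x) ^ d) ^ d)
      ((d : ℝ) ^ 2 * c ^ 2 / ((1 + x) * (1 + c / (1 + x) ^ d)) ^ (d + 1)) x := by
  have key (y : ℝ) (hy : 0 < 1 + y) :
      HasDerivAt (fun x : ℝ => c / (1 + x) ^ d) (-(d * c) / (1 + y) ^ (d + 1)) y := by
    have h := (((hasDerivAt_id y).const_add 1).fun_pow d).fun_inv (pow_pos hy d).ne'
    refine (h.const_mul c).congr_deriv ?_
    rcases d with _ | n
    · simp
    · simp only [id, Nat.add_sub_cancel]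
      field_simp
      ring
  have hx' : 0 < 1 + x := by linarith
  have hy : 0 < 1 + c / (1 + x) ^ d := by positivity
  refine ((key _ hy).comp x (key x hx')).congr_deriv ?_
  rw [mul_pow, div_mul_div_comm]
  ring

/-- The function `u ↦ u + c / u ^ n` is nondecreasing where `n * c ≤ u ^ (n + 1)`. -/
theorem add_div_pow_le_add_div_pow {n : ℕ} {c u v : ℝ} (hc : 0 ≤ c) (hu : 0 < u) (huv : u ≤ v)
    (h : n * c ≤ u ^ (n + 1)) : u + c / u ^ n ≤ v + c / v ^ n := by
  have hv : 0 < v := hu.trans_le huv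
  have bernoulli : 1 + n * (u / v - 1) ≤ (u / v) ^ n := by
    have := one_add_mul_le_pow (a := u / v - 1) (by linarith [div_pos hu hv]) n
    simpa using this
  have h1 : c / v ^ n = c / u ^ n * (u / v) ^ n := by
    rw [div_pow]; field_simp
  have h2 : c / u ^ n * (1 + n * (u / v - 1)) ≤ c / u ^ n * (u / v) ^ n :=
    mul_le_mul_of_nonneg_left bernoulli (by positivity)
  have h3 : n * c / u ^ (n + 1) * (u * (1 - u / v)) ≤ 1 * (u * (1 - u / v)) := by
    have : 0 ≤ 1 - u / v := sub_nonneg.2 ((div_le_one hv).2 huv)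
    exact mul_le_mul_of_nonneg_right ((div_le_one (by positivity)).2 h) (by positivity)
  have h4 : n * c / u ^ (n + 1) * (u * (1 - u / v)) = -(c / u ^ n * (n * (u / v - 1))) := by
    field_simp; ring
  have h5 : u * (1 - u / v) ≤ v - u := by
    have : v * (1 - u / v) = v - u := by field_simp
    rw [← this]
    exact mul_le_mul_of_nonneg_right huv (sub_nonneg.2 ((div_le_one hv).2 huv))
  rw [h1]
  linarith

/-- If `x * (1 + x) ^ (n + 1)` is at most its value at `1 / n`, then `x ≤ 1 / n`. -/
theorem mul_le_one_of_mul_one_add_pow_le {n : ℕ} (hn : 0 < n) {x : ℝ}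
    (h : x * (1 + x) ^ (n + 1) ≤ ((n : ℝ) + 1) ^ (n + 1) / (n : ℝ) ^ (n + 2)) : n * x ≤ 1 := by
  have hn' : (0 : ℝ) < n := by exact_mod_cast hn
  by_contra! hlt
  have h1 : 1 / (n : ℝ) < x := by rwa [div_lt_iff₀' hn']
  have h2 : 1 / (n : ℝ) * (1 + 1 / (n : ℝ)) ^ (n + 1) < x * (1 + x) ^ (n + 1) := by
    gcongr
  have h3 : 1 / (n : ℝ) * (1 + 1 / (n : ℝ)) ^ (n + 1)
      = ((n : ℝ) + 1) ^ (n + 1) / (n : ℝ) ^ (n + 2) := by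
    rw [one_add_div hn'.ne', div_pow]
    field_simp
    ring
  linarith

/-- For `d ≥ 2`, `k ≥ 1`, `0 < λ ≤ λ_c`, with `x̂` the unique positive fixed
point of `f(x) = kλ/(1+x)^d` and `g = f ∘ f`: `g'(x̂) = (d·x̂/(1+x̂))²`, `g'` is nonincreasing
on `[x̂,∞)`, and hence `g'(z) ≤ (d·x̂/(1+x̂))² ≤ 1` for every `z ≥ x̂`. -/
theorem stmt4 (d k : ℕ) (hd : 2 ≤ d) (hk : 1 ≤ k) (lam : ℝ) (hlam : 0 < lam)
    (hle : lam ≤ (d : ℝ) ^ d / ((k : ℝ) * ((d : ℝ) - 1) ^ (d + 1)))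
    (xhat : ℝ) (hx : 0 < xhat) (hfix : xhat = (k : ℝ) * lam / (1 + xhat) ^ d)
    (g : ℝ → ℝ)
    (hg : ∀ x : ℝ, g x = (k : ℝ) * lam / (1 + (k : ℝ) * lam / (1 + x) ^ d) ^ d) :
    deriv g xhat = ((d : ℝ) * xhat / (1 + xhat)) ^ 2 ∧
    AntitoneOn (deriv g) (Set.Ici xhat) ∧
    (∀ z : ℝ, xhat ≤ z → deriv g z ≤ ((d : ℝ) * xhat / (1 + xhat)) ^ 2) ∧
    ((d : ℝ) * xhat / (1 + xhat)) ^ 2 ≤ 1 := by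
  obtain ⟨n, rfl⟩ : ∃ n, d = n + 1 := ⟨d - 1, by omega⟩
  have hn : 0 < n := by omega
  have hk' : (0 : ℝ) < k := by exact_mod_cast hk
  have hn' : (0 : ℝ) < n := by exact_mod_cast hn
  have hc : 0 < (k : ℝ) * lam := by positivity
  have hle' : (k : ℝ) * lam ≤ ((n : ℝ) + 1) ^ (n + 1) / (n : ℝ) ^ (n + 2) := by
    push_cast at hle
    rw [add_sub_cancel_right, le_div_iff₀ (by positivity)] at hle
    rw [le_div_iff₀ (by positivity)]
    linarith
  generalize (k : ℝ) * lam = c at *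
  have hpos : 0 < 1 + xhat := by linarith
  have hceq : xhat * (1 + xhat) ^ (n + 1) = c := by
    rwa [eq_div_iff (by positivity)] at hfix
  have hnx : n * xhat ≤ 1 := mul_le_one_of_mul_one_add_pow_le hn (hceq.trans_le hle')
  have hderiv (z : ℝ) (hz : xhat ≤ z) : deriv g z =
      ((n + 1 : ℕ) : ℝ) ^ 2 * c ^ 2 / ((1 + z) * (1 + c / (1 + z) ^ (n + 1))) ^ (n + 1 + 1) := by
    rw [funext hg]
    exact (hasDerivAt_div_one_add_pow_comp_self (n + 1) hc (by linarith)).deriv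
  have hat : deriv g xhat = (((n + 1 : ℕ) : ℝ) * xhat / (1 + xhat)) ^ 2 := by
    rw [hderiv xhat le_rfl, ← hfix, ← hceq]
    generalize 1 + xhat = w at hpos
    field_simp
    ring
  have hanti : AntitoneOn (deriv g) (Set.Ici xhat) := by
    intro x hxx z hzz hxz
    rw [Set.mem_Ici] at hxx hzz
    rw [hderiv x hxx, hderiv z hzz]
    have hx0 : 0 < 1 + x := by linarith
    have hz0 : 0 < 1 + z := by linarith
    have expand (w : ℝ) (hw : 0 < 1 + w) :
        (1 + w) * (1 + c / (1 + w) ^ (n + 1)) = (1 + w) + c / (1 + w) ^ n := by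
      field_simp
      ring
    have hnc : n * c ≤ (1 + x) ^ (n + 1) := calc
      n * c = n * xhat * (1 + xhat) ^ (n + 1) := by rw [← hceq]; ring
      _ ≤ 1 * (1 + xhat) ^ (n + 1) := by gcongr
      _ ≤ (1 + x) ^ (n + 1) := by rw [one_mul]; gcongr
    rw [expand x hx0, expand z hz0]
    have := add_div_pow_le_add_div_pow hc.le hx0 (by linarith : 1 + x ≤ 1 + z) hnc
    gcongr
  refine ⟨hat, hanti, fun z hz => hat ▸ hanti Set.self_mem_Ici hz hz, ?_⟩
  refine pow_le_one₀ (by positivity) ((div_le_one hpos).2 ?_)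
  push_cast
  linarith
end

section
/- Let d ≥ 2 and k ≥ 1 be integers and 0 < λ ≤ λ_c = d^d/(k(d−1)^{d+1}). Then the system of equations y = kλ/(1+x)^d, x = kλ/(1+y)^d has a unique solution (x, y) with x, y > 0, namely x = y = x̂, the unique positive fixed point of f(x) = kλ/(1+x)^d. Equivalently, x̂ is the unique positive fixed point of g = f ∘ f. -/
open Finset in
lemma geom_sum_add_two (r : ℝ) (n : ℕ) :
    ∑ i ∈ range (n + 2), r ^ i = 1 + r * ∑ i ∈ range n, r ^ i + r ^ (n + 1) := by
  rw [sum_range_succ, sum_range_succ', mul_sum]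
  simp only [pow_succ']
  ring

open Finset in
/-- The arithmetic-geometric mean inequality for `1, q², …, q^(2n)`. -/
lemma mul_pow_le_geom_sum_sq (q : ℝ) (n : ℕ) :
    ((n : ℝ) + 1) * q ^ n ≤ ∑ i ∈ range (n + 1), (q ^ 2) ^ i := by
  induction n using Nat.twoStepInduction with
  | zero => simp
  | one => simp [sum_range_succ]; nlinarith [sq_nonneg (q - 1)]
  | more n ih _ =>
    rw [geom_sum_add_two (q ^ 2) (n + 1)]
    have h := mul_le_mul_of_nonneg_left ih (sq_nonneg q)
    have h₂ := sq_nonneg (q ^ (n + 2) - 1)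
    have h₃ : (q ^ 2) ^ (n + 1 + 1) = (q ^ (n + 2)) ^ 2 := by ring
    have h₄ : q ^ 2 * (((n : ℝ) + 1) * q ^ n) = ((n : ℝ) + 1) * q ^ (n + 2) := by ring
    push_cast
    rw [h₃]
    rw [h₄] at h
    linarith

open Finset in
lemma geom_sum_mul_geom_sum (r : ℝ) (n : ℕ) :
    (∑ i ∈ range (n + 2), r ^ i) * ∑ i ∈ range n, r ^ i
      = (∑ i ∈ range (n + 1), r ^ i) ^ 2 - r ^ n := by
  have h := geom_sum_add_two r n
  have h₁ : ∑ i ∈ range (n + 1), r ^ i = r * ∑ i ∈ range n, r ^ i + 1 := geom_sum_succ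
  have h₂ : ∑ i ∈ range (n + 1), r ^ i = ∑ i ∈ range n, r ^ i + r ^ n := sum_range_succ _ _
  rw [h]
  linear_combination -(∑ i ∈ range (n + 1), r ^ i) * h₂ - (∑ i ∈ range n, r ^ i + r ^ n) * h₁

/-- The mean of `1, r, …, r ^ n`. -/
noncomputable def geomMean (r : ℝ) (n : ℕ) : ℝ :=
  (∑ i ∈ Finset.range (n + 1), r ^ i) / ((n : ℝ) + 1)

lemma geomMean_pos {r : ℝ} (hr : 0 < r) (n : ℕ) : 0 < geomMean r n :=
  div_pos (Finset.sum_pos (fun _ _ => pow_pos hr _) (by simp)) (by positivity)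

lemma geomMean_sq_le {r : ℝ} (hr : 0 < r) (n : ℕ) :
    geomMean r (n + 1) ^ 2 ≤ geomMean r (n + 2) * geomMean r n := by
  have amgm : ((n : ℝ) + 2) ^ 2 * r ^ (n + 1) ≤ (∑ i ∈ Finset.range (n + 2), r ^ i) ^ 2 := by
    have h := mul_pow_le_geom_sum_sq (√r) (n + 1)
    rw [Real.sq_sqrt hr.le] at h
    have h' := pow_le_pow_left₀ (by positivity) h 2
    rw [mul_pow, ← pow_mul, mul_comm (n + 1) 2, pow_mul, Real.sq_sqrt hr.le] at h'
    have hn : ((n + 1 : ℕ) : ℝ) + 1 = n + 2 := by push_cast; ring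
    rwa [hn] at h'
  have h := geom_sum_mul_geom_sum r (n + 1)
  unfold geomMean
  rw [div_pow, div_mul_div_comm, h, div_le_div_iff₀ (by positivity) (by positivity)]
  push_cast
  nlinarith [amgm]

lemma mul_geomMean_pow_lt {r : ℝ} (hr : 0 < r) (hr1 : r ≠ 1) (n : ℕ) :
    r * geomMean r n ^ (n + 3) < geomMean r (n + 1) ^ (n + 2) := by
  induction n with
  | zero =>
    have : 0 < (r - 1) ^ 2 := by have := sub_ne_zero.2 hr1; positivity
    simp [geomMean, Finset.sum_range_succ]
    nlinarith
  | succ n ih =>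
    have h := pow_le_pow_left₀ (by positivity) (geomMean_sq_le hr n) (n + 3)
    rw [mul_pow] at h
    have p₁ := geomMean_pos hr (n + 1)
    have p₂ := geomMean_pos hr (n + 2)
    refine lt_of_mul_lt_mul_right ?_ (pow_pos p₁ (n + 2)).le
    calc r * geomMean r (n + 1) ^ (n + 1 + 3) * geomMean r (n + 1) ^ (n + 2)
        = r * (geomMean r (n + 1) ^ 2) ^ (n + 3) := by ring
      _ ≤ r * (geomMean r (n + 2) ^ (n + 3) * geomMean r n ^ (n + 3)) := by gcongr
      _ = geomMean r (n + 2) ^ (n + 3) * (r * geomMean r n ^ (n + 3)) := by ring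
      _ < geomMean r (n + 2) ^ (n + 3) * geomMean r (n + 1) ^ (n + 2) := by gcongr

/-- A positive solution of the system with `x ≠ y` forces `c` above the critical value. -/
lemma critical_lt_of_ne {n : ℕ} {c x y : ℝ} (hx : 0 < x) (hy : 0 < y) (hxy : x ≠ y)
    (h₁ : y * (1 + x) ^ (n + 2) = c) (h₂ : x * (1 + y) ^ (n + 2) = c) :
    ((n : ℝ) + 2) ^ (n + 2) / ((n : ℝ) + 1) ^ (n + 3) < c := by
  obtain ⟨r, hr⟩ : ∃ r, r = (1 + y) / (1 + x) := ⟨_, rfl⟩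
  have hr0 : 0 < r := hr ▸ by positivity
  have hb : 1 + y = r * (1 + x) := by rw [hr]; field_simp
  have hr1 : r ≠ 1 := by
    rintro rfl
    exact hxy (by linarith)
  have hr1' : r - 1 ≠ 0 := sub_ne_zero.2 hr1
  have key := mul_geomMean_pow_lt hr0 hr1 n
  unfold geomMean at key
  obtain ⟨S, hS⟩ : ∃ S, S = ∑ i ∈ Finset.range (n + 1), r ^ i := ⟨_, rfl⟩
  have hS0 : 0 < S := hS ▸ Finset.sum_pos (fun _ _ => pow_pos hr0 _) (by simp)
  have hT : ∑ i ∈ Finset.range (n + 1 + 1), r ^ i = r * S + 1 := by rw [hS]; exact geom_sum_succ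
  have hg : S * (r - 1) = r ^ (n + 1) - 1 := hS ▸ geom_sum_mul r (n + 1)
  have hrp : x * r ^ (n + 2) = y := by
    have : (x * r ^ (n + 2)) * (1 + x) ^ (n + 2) = y * (1 + x) ^ (n + 2) := by
      rw [h₁, ← h₂, hb, mul_pow]; ring
    exact mul_right_cancel₀ (by positivity) this
  have hxS : x * (r * S) = 1 := by
    apply mul_right_cancel₀ hr1'
    have : r ^ (n + 2) = r * r ^ (n + 1) := by ring
    rw [this] at hrp
    linear_combination x * r * hg + hrp + hb
  have hbS : (1 + y) * S = r * S + 1 := by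
    rw [hb]; linear_combination hxS
  rw [hT, ← hS, ← hbS, div_pow, div_pow, mul_div_assoc', div_lt_div_iff₀ (by positivity)
    (by positivity)] at key
  rw [div_lt_iff₀ (by positivity), ← h₂]
  refine lt_of_mul_lt_mul_left ?_ (by positivity : 0 ≤ r * S ^ (n + 3))
  push_cast at key
  calc r * S ^ (n + 3) * ((n : ℝ) + 2) ^ (n + 2)
      = r * S ^ (n + 3) * ((n : ℝ) + 1 + 1) ^ (n + 2) := by ring
    _ < ((1 + y) * S) ^ (n + 2) * ((n : ℝ) + 1) ^ (n + 3) := key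
    _ = (x * (r * S)) * (((1 + y) * S) ^ (n + 2) * ((n : ℝ) + 1) ^ (n + 3)) := by
      rw [hxS, one_mul]
    _ = r * S ^ (n + 3) * (x * (1 + y) ^ (n + 2) * ((n : ℝ) + 1) ^ (n + 3)) := by
      rw [mul_pow]; ring


/-- For `d ≥ 2`, `k ≥ 1`, `0 < λ ≤ λ_c`, the system `y = kλ/(1+x)^d`,
`x = kλ/(1+y)^d` has a unique positive solution, namely `x = y = x̂`, the unique positive
fixed point of `f(x) = kλ/(1+x)^d`. -/
theorem stmt5 (d k : ℕ) (hd : 2 ≤ d) (hk : 1 ≤ k) (lam : ℝ) (hlam : 0 < lam)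
    (hle : lam ≤ (d : ℝ) ^ d / ((k : ℝ) * ((d : ℝ) - 1) ^ (d + 1)))
    (xhat : ℝ) (hx : 0 < xhat) (hfix : xhat = (k : ℝ) * lam / (1 + xhat) ^ d) :
    ∀ x y : ℝ, 0 < x → 0 < y →
      y = (k : ℝ) * lam / (1 + x) ^ d → x = (k : ℝ) * lam / (1 + y) ^ d →
      x = xhat ∧ y = xhat := by
  intro x y hx0 hy0 h₁ h₂
  rw [eq_div_iff (by positivity)] at h₁ h₂ hfix
  have hk0 : (0 : ℝ) < k := by exact_mod_cast hk
  obtain rfl : x = y := by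
    by_contra hxy
    obtain ⟨n, rfl⟩ := Nat.exists_eq_add_of_le' hd
    have h := critical_lt_of_ne hx0 hy0 hxy h₁ h₂
    have hn : (((n + 2 : ℕ) : ℝ) - 1) = (n : ℝ) + 1 := by push_cast; ring
    rw [hn, mul_comm (k : ℝ), ← div_div, le_div_iff₀ hk0] at hle
    push_cast at hle
    linarith
  have key : x = xhat := by
    rcases lt_trichotomy x xhat with h | h | h
    · have : x * (1 + x) ^ d < xhat * (1 + xhat) ^ d := by gcongr
      linarith
    · exact h
    · have : xhat * (1 + xhat) ^ d < x * (1 + x) ^ d := by gcongr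
      linarith
  exact ⟨key, key⟩
end

section
/- Let d ≥ 2 and k ≥ 1 be integers and λ > λ_c = d^d/(k(d−1)^{d+1}). Then the system y = kλ/(1+x)^d, x = kλ/(1+y)^d has exactly three solutions with x, y > 0: the symmetric solution (x̂, x̂) where x̂ is the unique positive fixed point of f(x) = kλ/(1+x)^d, and two asymmetric solutions (x⁺, x⁻) and (x⁻, x⁺) with 0 < x⁻ < x̂ < x⁺. -/
theorem hasDerivAt_mul_one_add_div_pow (d : ℕ) (hd : 1 ≤ d) (C x : ℝ) (hx : 0 < 1 + x) :
    HasDerivAt (fun x : ℝ => x * (1 + C / (1 + x) ^ d) ^ d)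
      ((1 + C / (1 + x) ^ d) ^ (d - 1) *
        (1 + C / (1 + x) ^ d - d ^ 2 * x * (C / (1 + x) ^ d) / (1 + x))) x := by
  obtain ⟨n, rfl⟩ : ∃ n, d = n + 1 := ⟨d - 1, by omega⟩
  have h1 : HasDerivAt (fun x : ℝ => 1 + x) 1 x := (hasDerivAt_id x).const_add 1
  have h2 := (((hasDerivAt_const x C).div (h1.pow (n + 1)) (pow_pos hx _).ne').const_add 1).pow
    (n + 1)
  have h3 := (hasDerivAt_id x).mul h2
  refine h3.congr_deriv ?_
  simp only [Pi.pow_apply, Pi.div_apply, id, Nat.add_sub_cancel]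
  have hp : (1 + x) ^ n ≠ 0 := (pow_pos hx _).ne'
  rw [pow_succ (1 + C / (1 + x) ^ (n + 1)) n]
  generalize (1 + C / (1 + x) ^ (n + 1)) ^ n = A
  rw [pow_succ (1 + x) n]
  generalize (1 + x) ^ n = B at *
  push_cast
  field_simp
  ring

theorem pow_succ_eq_of_deriv_eq_zero (d : ℕ) {C x : ℝ} (hC : 0 < C) (hx : 0 < 1 + x)
    (h : (1 + C / (1 + x) ^ d) ^ (d - 1) *
        (1 + C / (1 + x) ^ d - d ^ 2 * x * (C / (1 + x) ^ d) / (1 + x)) = 0) :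
    (1 + x) ^ (d + 1) = C * ((d ^ 2 - 1) * x - 1) := by
  have hp : 0 < (1 + x) ^ d := pow_pos hx _
  have h1 : (1 + C / (1 + x) ^ d) ^ (d - 1) ≠ 0 := by positivity
  have h2 := (mul_eq_zero.mp h).resolve_left h1
  rw [pow_succ]
  field_simp at h2
  linear_combination h2

theorem pow_ne_affine_of_lt_of_lt (n : ℕ) (hn : 2 ≤ n) (A B : ℝ) {u v w : ℝ}
    (hu : 0 ≤ 1 + u) (huv : u < v) (hvw : v < w) (h1 : (1 + u) ^ n = A * u + B)
    (h2 : (1 + v) ^ n = A * v + B) (h3 : (1 + w) ^ n = A * w + B) : False := by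
  have h := (strictConvexOn_pow hn).slope_strict_mono_adjacent (x := 1 + u) (y := 1 + v)
    (z := 1 + w) hu (by simp only [Set.mem_Ici]; linarith) (by linarith) (by linarith)
  simp only [h1, h2, h3] at h
  rw [div_lt_div_iff₀ (by linarith) (by linarith)] at h
  nlinarith

/-- The map `x ↦ x (1 + C / (1 + x) ^ d) ^ d` takes the same value at most three times
on the positive axis. -/
theorem mul_one_add_div_pow_not_four (d : ℕ) (hd : 1 ≤ d) {C E : ℝ} (hC : 0 < C) {p q r s : ℝ}
    (hp0 : 0 < p) (hpq : p < q) (hqr : q < r) (hrs : r < s)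
    (hp : p * (1 + C / (1 + p) ^ d) ^ d = E) (hq : q * (1 + C / (1 + q) ^ d) ^ d = E)
    (hr : r * (1 + C / (1 + r) ^ d) ^ d = E) (hs : s * (1 + C / (1 + s) ^ d) ^ d = E) :
    False := by
  have key : ∀ a b : ℝ, 0 < a → a < b → a * (1 + C / (1 + a) ^ d) ^ d = E →
      b * (1 + C / (1 + b) ^ d) ^ d = E →
      ∃ c ∈ Set.Ioo a b, (1 + c) ^ (d + 1) = C * (d ^ 2 - 1) * c + -C := by
    intro a b ha hab h1 h2
    have hder : ∀ x, a ≤ x → _ := fun x hx =>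
      hasDerivAt_mul_one_add_div_pow d hd C x (by linarith)
    obtain ⟨c, hc, h⟩ := exists_hasDerivAt_eq_zero hab
      (fun x hx => (hder x hx.1).continuousAt.continuousWithinAt) (h1.trans h2.symm)
      (fun x hx => hder x hx.1.le)
    refine ⟨c, hc, ?_⟩
    rw [pow_succ_eq_of_deriv_eq_zero d hC (by linarith [hc.1]) h]
    ring
  obtain ⟨u, hu, h1⟩ := key p q hp0 hpq hp hq
  obtain ⟨v, hv, h2⟩ := key q r (by linarith) hqr hq hr
  obtain ⟨w, hw, h3⟩ := key r s (by linarith) hrs hr hs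
  exact pow_ne_affine_of_lt_of_lt (d + 1) (by omega) _ _ (by linarith [hu.1]) (hu.2.trans hv.1)
    (hv.2.trans hw.1) h1 h2 h3

theorem one_lt_mul_of_lt_mul_pow (d : ℕ) (hd : 2 ≤ d) {x C : ℝ} (hx : 0 < x)
    (hC : C = x * (1 + x) ^ d) (h : (d : ℝ) ^ d / ((d : ℝ) - 1) ^ (d + 1) < C) :
    1 < ((d : ℝ) - 1) * x := by
  have hd' : (2 : ℝ) ≤ d := by exact_mod_cast hd
  have he : 0 < (d : ℝ) - 1 := by linarith
  by_contra! hle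
  rw [div_lt_iff₀ (by positivity), hC] at h
  have h1 : x * (1 + x) ^ d * ((d : ℝ) - 1) ^ (d + 1) =
      (((d : ℝ) - 1) * x) * (((d : ℝ) - 1) * (1 + x)) ^ d := by
    rw [mul_pow]; ring
  have h2 : (((d : ℝ) - 1) * (1 + x)) ^ d ≤ (d : ℝ) ^ d := by
    apply pow_le_pow_left₀ (by positivity)
    linarith
  have h3 : (((d : ℝ) - 1) * x) * (((d : ℝ) - 1) * (1 + x)) ^ d ≤ 1 * (d : ℝ) ^ d := by
    gcongr
  linarith

theorem exists_lt_of_hasDerivAt_neg {f : ℝ → ℝ} {f' a b : ℝ} (hab : a < b)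
    (h : HasDerivAt f f' b) (hf' : f' < 0) : ∃ z ∈ Set.Ioo a b, f b < f z := by
  have h1 := (hasDerivAt_iff_tendsto_slope.mp h).eventually_lt_const hf'
  have h2 : ∀ᶠ z in nhdsWithin b (Set.Iio b), slope f b z < 0 :=
    h1.filter_mono (nhdsWithin_mono _ fun z hz => ne_of_lt hz)
  obtain ⟨z, hz, hm⟩ := (h2.and (Ioo_mem_nhdsLT hab)).exists
  refine ⟨z, hm, ?_⟩
  rw [slope_def_field, div_neg_iff] at hz
  rcases hz with hz | hz <;> linarith [hm.2]


/-- For `d ≥ 2`, `k ≥ 1` and `λ > λ_c = d^d/(k(d−1)^(d+1))`, the system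
`y = kλ/(1+x)^d`, `x = kλ/(1+y)^d` has exactly three positive solutions: the symmetric one
`(x̂, x̂)` and two asymmetric ones `(x⁺, x⁻)`, `(x⁻, x⁺)` with `0 < x⁻ < x̂ < x⁺`. -/
theorem stmt6 (d k : ℕ) (hd : 2 ≤ d) (hk : 1 ≤ k) (lam : ℝ) (hlam : 0 < lam)
    (hgt : (d : ℝ) ^ d / ((k : ℝ) * ((d : ℝ) - 1) ^ (d + 1)) < lam)
    (xhat : ℝ) (hx : 0 < xhat) (hfix : xhat = (k : ℝ) * lam / (1 + xhat) ^ d) :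
    ∃ xp xm : ℝ, 0 < xm ∧ xm < xhat ∧ xhat < xp ∧
      (xm = (k : ℝ) * lam / (1 + xp) ^ d ∧ xp = (k : ℝ) * lam / (1 + xm) ^ d) ∧
      ∀ x y : ℝ, 0 < x → 0 < y →
        y = (k : ℝ) * lam / (1 + x) ^ d → x = (k : ℝ) * lam / (1 + y) ^ d →
        (x = xhat ∧ y = xhat) ∨ (x = xp ∧ y = xm) ∨ (x = xm ∧ y = xp) := by
  have hk' : (0 : ℝ) < k := by exact_mod_cast hk
  have hd' : (2 : ℝ) ≤ d := by exact_mod_cast hd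
  have he : (0 : ℝ) < d - 1 := by linarith
  have hC : 0 < (k : ℝ) * lam := by positivity
  have hgt' : (d : ℝ) ^ d / ((d : ℝ) - 1) ^ (d + 1) < k * lam := by
    rw [div_lt_iff₀ (by positivity)] at hgt ⊢
    linarith
  generalize (k : ℝ) * lam = C at *
  have hsol : ∀ x y : ℝ, 0 < x → y = C / (1 + x) ^ d → x = C / (1 + y) ^ d →
      x * (1 + C / (1 + x) ^ d) ^ d = C := by
    intro x y hx0 hy hxy
    have : 0 < y := by rw [hy]; positivity
    rw [← hy]
    exact (eq_div_iff (by positivity)).mp hxy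
  have hxC : C = xhat * (1 + xhat) ^ d := ((eq_div_iff (by positivity)).mp hfix).symm
  have hlt := one_lt_mul_of_lt_mul_pow d hd hx hxC hgt'
  have hder := fun x (hx : 0 ≤ x) =>
    hasDerivAt_mul_one_add_div_pow d (by omega) C x (by linarith)
  have hxhat := hsol xhat xhat hx hfix hfix
  obtain ⟨z, hz, hlt_z⟩ := exists_lt_of_hasDerivAt_neg hx (hder xhat hx.le) (by
    rw [← hfix]
    apply mul_neg_of_pos_of_neg (by positivity)
    rw [sub_neg, lt_div_iff₀ (by linarith)]
    nlinarith)
  simp only [hxhat] at hlt_z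
  obtain ⟨xm, hxm, hval⟩ := intermediate_value_Ioo hz.1.le
    (fun x hx => (hder x hx.1).continuousAt.continuousWithinAt)
    (show C ∈ Set.Ioo _ _ from ⟨by simpa using hC, hlt_z⟩)
  have hxm0 : 0 < xm := hxm.1
  have hxm1 : xm < xhat := hxm.2.trans hz.2
  have hxp : xhat < C / (1 + xm) ^ d := by
    conv_lhs => rw [hfix]
    have : (1 + xm) ^ d < (1 + xhat) ^ d := pow_lt_pow_left₀ (by linarith) (by linarith) (by omega)
    gcongr
  have hxm2 : xm = C / (1 + C / (1 + xm) ^ d) ^ d := (eq_div_iff (by positivity)).mpr hval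
  have hxpval := hsol (C / (1 + xm) ^ d) xm (by positivity) hxm2 rfl
  refine ⟨C / (1 + xm) ^ d, xm, hxm0, hxm1, hxp, ⟨hxm2, rfl⟩, fun x y hx0 hy0 hy hxy => ?_⟩
  have hxval := hsol x y hx0 hy hxy
  have four := fun {p q r s : ℝ} => @mul_one_add_div_pow_not_four d (by omega) C C hC p q r s
  rcases lt_trichotomy x xhat with h | h | h
  · rcases lt_trichotomy x xm with h' | h' | h'
    · exact (four hx0 h' hxm1 hxp hxval hval hxhat hxpval).elim
    · exact .inr (.inr ⟨h', h' ▸ hy⟩)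
    · exact (four hxm0 h' h hxp hval hxval hxhat hxpval).elim
  · exact .inl ⟨h, by rw [hy, h, ← hfix]⟩
  · rcases lt_trichotomy x (C / (1 + xm) ^ d) with h' | h' | h'
    · exact (four hxm0 hxm1 h h' hval hxhat hxval hxpval).elim
    · exact .inr (.inl ⟨h', by rw [hy, h', ← hxm2]⟩)
    · exact (four hxm0 hxm1 hxp h' hval hxhat hxpval hxval).elim
end

section
/- Let d ≥ 2 and k ≥ 1 be integers and λ = λ_c = d^d/(k(d−1)^{d+1}) (the critical activity). With u_1 = kλ, v_1 = 0, u_{ℓ+1} = kλ/(1+v_ℓ)^d, v_{ℓ+1} = kλ/(1+u_ℓ)^d, and x̂ = 1/(d−1) the positive fixed point of f(x) = kλ/(1+x)^d: there exist constants γ > 0 and t₀ ∈ ℕ such that for all t ≥ t₀, u_{2t+1} − x̂ ≤ γ/√(t − t₀ + 2); consequently there exist constants C > 0 and ℓ₀ ∈ ℕ such that for all ℓ > ℓ₀, u_ℓ − v_ℓ ≤ C/√(ℓ − ℓ₀). In particular at criticality the gap u_ℓ − v_ℓ decays polynomially (as 1/√ℓ). -/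
/-- The recursion map `x ↦ kλ_c / (1 + x) ^ d` in the coordinate `s` given by
`1 + x = d / (d - 1) * (1 + s)`, in which the fixed point is `0`. -/
noncomputable def criticalMap (d : ℕ) (s : ℝ) : ℝ := (((1 + s) ^ d)⁻¹ - 1) / d

theorem one_add_mul_add_sq_le_pow (m : ℕ) {s : ℝ} (hs : 0 ≤ s) :
    1 + m * s + m * (m - 1) / 2 * s ^ 2 ≤ (1 + s) ^ m := by
  induction m with
  | zero => simp
  | succ m ih =>
    have h := mul_le_mul_of_nonneg_right ih (by linarith : 0 ≤ 1 + s)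
    have h2 : 0 ≤ (m : ℝ) * (m - 1) := by
      rcases m with _ | m
      · simp
      · push_cast
        have : (0 : ℝ) ≤ m := m.cast_nonneg
        nlinarith
    have h3 : 0 ≤ (m : ℝ) * (m - 1) * s ^ 3 := by positivity
    rw [pow_succ (1 + s)]
    push_cast
    nlinarith

theorem one_add_criticalMap {d : ℕ} (hd : 2 ≤ d) (s : ℝ) :
    1 + criticalMap d s = ((d - 1 : ℝ) + ((1 + s) ^ d)⁻¹) / d := by
  have : (d : ℝ) ≠ 0 := by positivity
  unfold criticalMap
  field_simp
  ring

theorem one_add_criticalMap_pos {d : ℕ} (hd : 2 ≤ d) {s : ℝ} (hs : 0 < 1 + s) :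
    0 < 1 + criticalMap d s := by
  rw [one_add_criticalMap hd]
  have : (2 : ℝ) ≤ d := by exact_mod_cast hd
  have : (0 : ℝ) < d - 1 := by linarith
  positivity

theorem criticalMap_zero (d : ℕ) : criticalMap d 0 = 0 := by
  simp [criticalMap]

theorem criticalMap_anti (d : ℕ) {s t : ℝ} (hs : 0 < 1 + s) (hst : s ≤ t) :
    criticalMap d t ≤ criticalMap d s := by
  unfold criticalMap
  gcongr

theorem neg_le_criticalMap {d : ℕ} (hd : 2 ≤ d) {s : ℝ} (hs : 0 ≤ s) :
    -s ≤ criticalMap d s := by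
  have hd' : (0 : ℝ) < d := by positivity
  have hs1 : 0 < 1 + s := by linarith
  have hinv : (1 + s)⁻¹ = 1 + -(s / (1 + s)) := by
    field_simp
    ring
  have hdiv : s / (1 + s) ≤ s := div_le_self hs (by linarith)
  have hdiv1 : s / (1 + s) ≤ 1 := (div_le_one hs1).2 (by linarith)
  have hb := one_add_mul_le_pow (by linarith : (-2 : ℝ) ≤ -(s / (1 + s))) d
  have hmul := mul_le_mul_of_nonneg_left hdiv hd'.le
  unfold criticalMap
  rw [le_div_iff₀ hd', ← inv_pow, hinv]
  linarith

theorem hasDerivAt_criticalMap {d : ℕ} (hd : 2 ≤ d) {s : ℝ} (hs : 0 < 1 + s) :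
    HasDerivAt (criticalMap d) (-((1 + s) ^ (d + 1))⁻¹) s := by
  have hd' : (d : ℝ) ≠ 0 := by positivity
  have h := ((((hasDerivAt_id s).const_add 1).pow d).inv (by simpa using (pow_pos hs d).ne')).sub_const 1
    |>.div_const (d : ℝ)
  refine h.congr_deriv ?_
  obtain ⟨m, rfl⟩ : ∃ m, d = m + 1 := ⟨d - 1, by omega⟩
  simp only [Pi.pow_apply, id, Nat.add_sub_cancel]
  field_simp
  ring

/-- Cubic contraction of the second iterate of `criticalMap` on `[0, S]`. -/
theorem criticalMap_criticalMap_le {d : ℕ} (hd : 2 ≤ d) {S c : ℝ} (hS : 0 ≤ S) (hc : 0 < c)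
    (hcS : 3 * c * (1 + d * S + ((d : ℝ) ^ 2 - 1) / 2 * S ^ 2) ≤ ((d : ℝ) ^ 2 - 1) / 2)
    {s : ℝ} (hs : s ∈ Set.Icc 0 S) :
    criticalMap d (criticalMap d s) ≤ s - c * s ^ 3 := by
  have hd2 : (2 : ℝ) ≤ d := by exact_mod_cast hd
  have hd0 : (0 : ℝ) < d := by linarith
  have hc1 : ∀ x ∈ Set.Icc 0 S, 3 * c * x ^ 2 ≤ 1 := by
    intro x hx
    have hx2 : x ^ 2 ≤ S ^ 2 := pow_le_pow_left₀ hx.1 hx.2 2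
    have hK : 0 < ((d : ℝ) ^ 2 - 1) / 2 := by nlinarith
    have h1 : ((d : ℝ) ^ 2 - 1) / 2 * (3 * c * S ^ 2) ≤ ((d : ℝ) ^ 2 - 1) / 2 * 1 := by
      have : 0 ≤ 3 * c * (1 + d * S) := by positivity
      nlinarith
    have h2 := le_of_mul_le_mul_left h1 hK
    nlinarith
  let P : ℝ → ℝ := fun x => (1 + criticalMap d x) ^ d * (1 + d * (x - c * x ^ 3))
  have hP : ∀ x ∈ Set.Icc 0 S, HasDerivAt P
      (d * (1 + criticalMap d x) ^ (d - 1) * (-((1 + x) ^ (d + 1))⁻¹) *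
        (1 + d * (x - c * x ^ 3)) +
        (1 + criticalMap d x) ^ d * (d * (1 - c * (3 * x ^ 2)))) x := by
    intro x hx
    have hx1 : 0 < 1 + x := by linarith [hx.1]
    have h1 := ((hasDerivAt_criticalMap hd hx1).const_add 1).pow d
    have h2 := (((hasDerivAt_id x).sub ((hasDerivAt_pow 3 x).const_mul c)).const_mul
      (d : ℝ)).const_add 1
    refine (h1.mul h2).congr_deriv ?_
    simp
  have hmono : MonotoneOn P (Set.Icc 0 S) := by
    refine monotoneOn_of_deriv_nonneg (convex_Icc 0 S)
      (fun x hx => (hP x hx).continuousAt.continuousWithinAt)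
      (fun x hx => (hP x (interior_subset hx)).differentiableAt.differentiableWithinAt) ?_
    intro x hx
    have hx := interior_subset hx
    rw [(hP x hx).deriv]
    have hx0 : 0 ≤ x := hx.1
    have hx1 : 0 < 1 + x := by linarith
    have hG := one_add_criticalMap_pos hd hx1
    have hcx := hc1 x hx
    have hpow := one_add_mul_add_sq_le_pow (d + 1) hx0
    push_cast at hpow
    have hbr : d * (1 + d * (x - c * x ^ 3)) ≤
        ((d - 1) * (1 + x) ^ (d + 1) + (1 + x)) * (1 - 3 * c * x ^ 2) := by
      have hA : d * (1 + d * x + ((d : ℝ) ^ 2 - 1) / 2 * x ^ 2) ≤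
          (d - 1) * (1 + x) ^ (d + 1) + (1 + x) := by
        have := mul_le_mul_of_nonneg_left hpow (by linarith : (0 : ℝ) ≤ d - 1)
        nlinarith
      refine le_trans ?_ (mul_le_mul_of_nonneg_right hA (by linarith))
      rw [mul_assoc]
      refine mul_le_mul_of_nonneg_left ?_ hd0.le
      have hKx : 3 * c * (1 + d * x + ((d : ℝ) ^ 2 - 1) / 2 * x ^ 2) ≤
          ((d : ℝ) ^ 2 - 1) / 2 := by
        refine le_trans ?_ hcS
        have hK : 0 ≤ ((d : ℝ) ^ 2 - 1) / 2 := by nlinarith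
        have := hx.2
        gcongr
      have h3 : 0 ≤ d * c * x ^ 3 := by positivity
      have := mul_le_mul_of_nonneg_right hKx (sq_nonneg x)
      nlinarith
    have hfac : d * (1 + criticalMap d x) ^ (d - 1) * (-((1 + x) ^ (d + 1))⁻¹) *
        (1 + d * (x - c * x ^ 3)) +
        (1 + criticalMap d x) ^ d * (d * (1 - c * (3 * x ^ 2))) =
        (1 + criticalMap d x) ^ (d - 1) * ((1 + x) ^ (d + 1))⁻¹ *
        (((d - 1) * (1 + x) ^ (d + 1) + (1 + x)) * (1 - 3 * c * x ^ 2) -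
          d * (1 + d * (x - c * x ^ 3))) := by
      have hsplit : (1 + criticalMap d x) ^ d =
          (1 + criticalMap d x) ^ (d - 1) * (1 + criticalMap d x) := by
        rw [← pow_succ]
        congr 1
        omega
      have hone : d * (1 + criticalMap d x) =
          ((1 + x) ^ (d + 1))⁻¹ * ((d - 1) * (1 + x) ^ (d + 1) + (1 + x)) := by
        rw [one_add_criticalMap hd]
        field_simp
        ring
      rw [hsplit]
      linear_combination (1 + criticalMap d x) ^ (d - 1) * (1 - 3 * c * x ^ 2) * hone
    rw [hfac]
    have : 0 ≤ ((d - 1) * (1 + x) ^ (d + 1) + (1 + x)) * (1 - 3 * c * x ^ 2) -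
          d * (1 + d * (x - c * x ^ 3)) := by linarith
    positivity
  have h := hmono (Set.left_mem_Icc.2 hS) hs hs.1
  have h0 : P 0 = 1 := by simp [P, criticalMap_zero]
  rw [h0] at h
  have hG := one_add_criticalMap_pos hd (by linarith [hs.1] : 0 < 1 + s)
  change (((1 + criticalMap d s) ^ d)⁻¹ - 1) / d ≤ _
  rw [div_le_iff₀ hd0, sub_le_iff_le_add, inv_le_iff_one_le_mul₀ (by positivity)]
  refine h.trans_eq ?_
  simp only [P]
  ring

theorem sq_mul_add_two_le_one {b c n s s' : ℝ} (hb : 0 < b) (hbc : 2 * b ≤ c) (hn : 0 ≤ n)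
    (hs' : 0 ≤ s') (hs : 0 ≤ s) (hstep : s' ≤ s - c * s ^ 3) (h : b * n * s ^ 2 ≤ 1) :
    b * (n + 2) * s' ^ 2 ≤ 1 := by
  set z := s ^ 2 with hz
  have hz0 : 0 ≤ z := sq_nonneg s
  have hc : 0 < c := by linarith
  have hsz : s' ≤ s * (1 - c * z) := by rw [hz]; linarith
  have hsq : s' ^ 2 ≤ z * (1 - c * z) ^ 2 := by
    calc s' ^ 2 ≤ (s * (1 - c * z)) ^ 2 := pow_le_pow_left₀ hs' hsz 2
      _ = z * (1 - c * z) ^ 2 := by rw [hz]; ring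
  rcases hs.eq_or_lt with rfl | hpos
  · have : s' = 0 := le_antisymm (by simpa using hsz) hs'
    simp [this]
  have h1 : 0 ≤ 1 - c * z := nonneg_of_mul_nonneg_right (hs'.trans hsz) hpos
  have hcz : 0 ≤ c * z := by positivity
  have h2 : b * (n + 2) * z ≤ 1 + c * z := by nlinarith
  calc b * (n + 2) * s' ^ 2 ≤ b * (n + 2) * (z * (1 - c * z) ^ 2) := by gcongr
    _ = (b * (n + 2) * z) * (1 - c * z) ^ 2 := by ring
    _ ≤ (1 + c * z) * (1 - c * z) ^ 2 := by gcongr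
    _ = (1 - (c * z) ^ 2) * (1 - c * z) := by ring
    _ ≤ 1 := mul_le_one₀ (by nlinarith) h1 (by linarith)

/-- Two interlaced critical orbits started on opposite sides of the fixed point approach it
at rate `1 / √ℓ`. -/
theorem exists_le_div_sqrt_of_criticalMap {d : ℕ} (hd : 2 ≤ d) (a b : ℕ → ℝ)
    (hb1 : 0 < 1 + b 1) (hb1' : b 1 ≤ 0) (ha1 : a 1 = criticalMap d (b 1))
    (ha : ∀ ℓ, 1 ≤ ℓ → a (ℓ + 1) = criticalMap d (b ℓ))
    (hb : ∀ ℓ, 1 ≤ ℓ → b (ℓ + 1) = criticalMap d (a ℓ)) :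
    ∃ Γ : ℝ, 0 < Γ ∧ ∀ ℓ : ℕ, 1 ≤ ℓ →
      a ℓ ≤ Γ / √(ℓ : ℝ) ∧ -b (ℓ + 1) ≤ Γ / √(ℓ : ℝ) := by
  have hd2 : (2 : ℝ) ≤ d := by exact_mod_cast hd
  have hK : 0 < ((d : ℝ) ^ 2 - 1) / 2 := by nlinarith
  set S := a 1 with hSdef
  have hS : 0 ≤ S := by
    rw [ha1, ← criticalMap_zero d]
    exact criticalMap_anti d hb1 hb1'
  set M := 1 + d * S + ((d : ℝ) ^ 2 - 1) / 2 * S ^ 2 with hM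
  have hMpos : 0 < M := by positivity
  set c := ((d : ℝ) ^ 2 - 1) / 2 / (3 * M) with hcdef
  have hc : 0 < c := by positivity
  have hcM : 3 * c * M ≤ ((d : ℝ) ^ 2 - 1) / 2 := by
    rw [hcdef]
    apply le_of_eq
    field_simp
  set β := min (c / 2) (1 / (2 * (S ^ 2 + 1))) with hβ
  have hβ0 : 0 < β := by positivity
  have hβc : 2 * β ≤ c := by linarith [min_le_left (c / 2) (1 / (2 * (S ^ 2 + 1)))]
  have hβS : β * 2 * S ^ 2 ≤ 1 := by
    have h := min_le_right (c / 2) (1 / (2 * (S ^ 2 + 1)))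
    rw [← hβ, le_div_iff₀ (by positivity)] at h
    nlinarith
  have ha2 : a 2 = S := (ha 1 le_rfl).trans ha1.symm
  have hstep : ∀ ℓ, 1 ≤ ℓ → a ℓ ∈ Set.Icc 0 S →
      0 ≤ a (ℓ + 2) ∧ a (ℓ + 2) ≤ a ℓ - c * a ℓ ^ 3 := by
    intro ℓ hℓ hm
    have h1 : 0 < 1 + a ℓ := by linarith [hm.1]
    have heq : a (ℓ + 2) = criticalMap d (criticalMap d (a ℓ)) := by
      rw [← hb ℓ hℓ]
      exact ha (ℓ + 1) (by omega)
    rw [heq]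
    refine ⟨?_, criticalMap_criticalMap_le hd hS hc hcM hm⟩
    have hle : criticalMap d (a ℓ) ≤ 0 := by
      simpa [criticalMap_zero] using criticalMap_anti d (by norm_num : (0 : ℝ) < 1 + 0) hm.1
    simpa [criticalMap_zero] using criticalMap_anti d (one_add_criticalMap_pos hd h1) hle
  have hmain : ∀ n : ℕ, (a (n + 1) ∈ Set.Icc 0 S ∧ β * (n + 1 : ℕ) * a (n + 1) ^ 2 ≤ 1) := by
    intro n
    induction n using Nat.twoStepInduction with
    | zero =>
      refine ⟨⟨hS, le_rfl⟩, ?_⟩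
      have : 0 ≤ β * S ^ 2 := by positivity
      norm_num
      linarith
    | one =>
      simp only [Nat.reduceAdd, ha2]
      exact ⟨⟨hS, le_rfl⟩, by exact_mod_cast hβS⟩
    | more n ih _ =>
      obtain ⟨hm, hle⟩ := ih
      obtain ⟨h0, h1⟩ := hstep (n + 1) (by omega) hm
      have h3 : 0 ≤ c * a (n + 1) ^ 3 := mul_nonneg hc.le (pow_nonneg hm.1 3)
      refine ⟨⟨h0, by linarith [hm.2]⟩, ?_⟩
      have := sq_mul_add_two_le_one hβ0 hβc (Nat.cast_nonneg _) h0 hm.1 h1 hle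
      convert this using 3
      push_cast
      ring
  refine ⟨1 / √β, by positivity, fun ℓ hℓ => ?_⟩
  obtain ⟨n, rfl⟩ : ∃ n, ℓ = n + 1 := ⟨ℓ - 1, by omega⟩
  obtain ⟨hm, hle⟩ := hmain n
  have hbd : a (n + 1) ≤ 1 / √β / √((n + 1 : ℕ) : ℝ) := by
    rw [div_div, ← Real.sqrt_mul hβ0.le, le_div_iff₀ (by positivity)]
    refine abs_le_of_sq_le_sq' ?_ zero_le_one |>.2
    rw [mul_pow, Real.sq_sqrt (by positivity)]
    linarith
  refine ⟨hbd, le_trans ?_ hbd⟩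
  rw [hb (n + 1) (by omega)]
  linarith [neg_le_criticalMap hd hm.1]


/-- For `d ≥ 2`, `k ≥ 1` and `λ = λ_c = d^d/(k(d−1)^(d+1))`, with `u_ℓ, v_ℓ` the
extremal recursion sequences and `x̂ = 1/(d−1)` the positive fixed point of
`f(x) = kλ/(1+x)^d`: there exist `γ > 0` and `t₀ ∈ ℕ` with
`u_{2t+1} − x̂ ≤ γ/√(t − t₀ + 2)` for all `t ≥ t₀`, and consequently there exist `C > 0`
and `ℓ₀ ∈ ℕ` with `u_ℓ − v_ℓ ≤ C/√(ℓ − ℓ₀)` for all `ℓ > ℓ₀`. -/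
theorem stmt9 (d k : ℕ) (hd : 2 ≤ d) (hk : 1 ≤ k) (lam : ℝ)
    (hlam : lam = (d : ℝ) ^ d / ((k : ℝ) * ((d : ℝ) - 1) ^ (d + 1)))
    (xhat : ℝ) (hxhat : xhat = 1 / ((d : ℝ) - 1))
    (hfix : xhat = (k : ℝ) * lam / (1 + xhat) ^ d)
    (u v : ℕ → ℝ) (hu1 : u 1 = (k : ℝ) * lam) (hv1 : v 1 = 0)
    (hu : ∀ ℓ, 1 ≤ ℓ → u (ℓ + 1) = (k : ℝ) * lam / (1 + v ℓ) ^ d)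
    (hv : ∀ ℓ, 1 ≤ ℓ → v (ℓ + 1) = (k : ℝ) * lam / (1 + u ℓ) ^ d) :
    (∃ γ : ℝ, 0 < γ ∧ ∃ t₀ : ℕ, ∀ t : ℕ, t₀ ≤ t →
      u (2 * t + 1) - xhat ≤ γ / Real.sqrt ((t : ℝ) - (t₀ : ℝ) + 2)) ∧
    (∃ C : ℝ, 0 < C ∧ ∃ ℓ₀ : ℕ, ∀ ℓ : ℕ, ℓ₀ < ℓ →
      u ℓ - v ℓ ≤ C / Real.sqrt ((ℓ : ℝ) - (ℓ₀ : ℝ))) := by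
  have hd2 : (2 : ℝ) ≤ d := by exact_mod_cast hd
  have hd1 : (0 : ℝ) < d - 1 := by linarith
  have hd0 : (0 : ℝ) < d := by linarith
  have hk0 : (0 : ℝ) < k := by exact_mod_cast hk
  set D : ℝ := d / (d - 1) with hD
  have hD0 : 0 < D := by positivity
  have hmap : ∀ x, (1 + (k : ℝ) * lam / (1 + x) ^ d) / D - 1 =
      criticalMap d ((1 + x) / D - 1) := by
    intro x
    have hkl : (k : ℝ) * lam = D ^ d / (d - 1) := by
      rw [hlam, hD, div_pow]
      field_simp
      ring
    have hinv : (((1 + x) / D) ^ d)⁻¹ = D ^ d / (1 + x) ^ d := by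
      rw [div_pow, inv_div]
    rw [hkl, criticalMap, add_sub_cancel, hinv, div_right_comm]
    generalize D ^ d / (1 + x) ^ d = q
    rw [hD]
    field_simp
    ring
  obtain ⟨Γ, hΓ, h⟩ := exists_le_div_sqrt_of_criticalMap hd
    (fun ℓ => (1 + u ℓ) / D - 1) (fun ℓ => (1 + v ℓ) / D - 1)
    (by simp only [hv1]; ring_nf; positivity)
    (by
      have : 1 ≤ D := by rw [hD, le_div_iff₀ hd1]; linarith
      simp only [hv1]
      rw [sub_nonpos, div_le_iff₀ hD0]
      linarith)
    (by simpa [hu1, hv1] using hmap 0)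
    (fun ℓ hℓ => by simp only [hu ℓ hℓ, hmap])
    (fun ℓ hℓ => by simp only [hv ℓ hℓ, hmap])
  have hxD : 1 + xhat = D := by
    rw [hxhat, hD]
    field_simp
    ring
  have hgap : ∀ y, y - xhat = D * ((1 + y) / D - 1) := by
    intro y
    rw [mul_sub, mul_div_cancel₀ _ hD0.ne', ← hxD]
    ring
  have hU : ∀ ℓ, 1 ≤ ℓ → u ℓ - xhat ≤ D * Γ / √(ℓ : ℝ) := by
    intro ℓ hℓ
    rw [hgap, mul_div_assoc]
    exact mul_le_mul_of_nonneg_left (h ℓ hℓ).1 hD0.le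
  have hV : ∀ ℓ, 1 ≤ ℓ → xhat - v (ℓ + 1) ≤ D * Γ / √(ℓ : ℝ) := by
    intro ℓ hℓ
    rw [← neg_sub, hgap, mul_div_assoc, ← mul_neg]
    exact mul_le_mul_of_nonneg_left (h ℓ hℓ).2 hD0.le
  refine ⟨⟨2 * (D * Γ), by positivity, 0, fun t _ => ?_⟩,
    2 * (D * Γ), by positivity, 1, fun ℓ hℓ => ?_⟩
  · refine (hU (2 * t + 1) (by omega)).trans ?_
    rw [div_le_div_iff₀ (by positivity) (by simp; positivity)]
    have hs : √((t : ℝ) - (0 : ℕ) + 2) ≤ 2 * √((2 * t + 1 : ℕ) : ℝ) := by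
      rw [Real.sqrt_le_left (by positivity), mul_pow, Real.sq_sqrt (by positivity)]
      push_cast
      linarith [(Nat.cast_nonneg t : (0 : ℝ) ≤ t)]
    calc D * Γ * √((t : ℝ) - (0 : ℕ) + 2) ≤ D * Γ * (2 * √((2 * t + 1 : ℕ) : ℝ)) := by gcongr
      _ = _ := by ring
  · obtain ⟨n, rfl⟩ : ∃ n, ℓ = n + 1 := ⟨ℓ - 1, by omega⟩
    have hn : 1 ≤ n := by omega
    have hn0 : (0 : ℝ) < n := by exact_mod_cast hn
    have h1 : D * Γ / √((n + 1 : ℕ) : ℝ) ≤ D * Γ / √(n : ℝ) := by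
      gcongr
      omega
    have h2 := hU (n + 1) (by omega)
    have h3 := hV n hn
    have h4 : ((n + 1 : ℕ) : ℝ) - (1 : ℕ) = n := by push_cast; ring
    rw [h4]
    calc u (n + 1) - v (n + 1) ≤ D * Γ / √(n : ℝ) + D * Γ / √(n : ℝ) := by linarith
      _ = _ := by ring
end

section
/- Let β > 0 be a real number and set γ = 1/√(2β). Let (ε_t)_{t≥0} be a sequence of nonnegative reals with ε_0 ≤ γ/√2 and satisfying ε_{t+1} ≤ ε_t − β·ε_t³ for every t ≥ 0. Then for every t ≥ 0, ε_t ≤ γ/√(t+2). -/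
theorem le_one_div_sqrt_div_sqrt_iff {a s x : ℝ} (ha : 0 < a) (hs : 0 < s) (hx : 0 ≤ x) :
    x ≤ 1 / Real.sqrt a / Real.sqrt s ↔ a * x ^ 2 * s ≤ 1 := by
  have h : 0 < Real.sqrt (a * s) := Real.sqrt_pos.2 (mul_pos ha hs)
  rw [div_div, ← Real.sqrt_mul ha.le, le_div_iff₀ h, ← sq_le_one_iff₀ (by positivity), mul_pow,
    Real.sq_sqrt (by positivity)]
  ring_nf

theorem mul_sq_mul_add_one_le_one_of_le_sub_cube {β s x y : ℝ} (hβ : 0 < β) (hs : 1 ≤ s)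
    (hy : 0 ≤ y) (hyx : y ≤ x - β * x ^ 3) (hxs : 2 * β * x ^ 2 * s ≤ 1) :
    2 * β * y ^ 2 * (s + 1) ≤ 1 := by
  set u := 2 * β * x ^ 2 with hu
  have hu0 : 0 ≤ u := by positivity
  have hu1 : u ≤ 1 := by nlinarith
  calc 2 * β * y ^ 2 * (s + 1) ≤ 2 * β * (x - β * x ^ 3) ^ 2 * (s + 1) := by gcongr
    _ = (1 - u / 2) ^ 2 * (u * s + u) := by rw [hu]; ring
    _ ≤ (1 - u / 2) ^ 2 * (1 + u) := by gcongr
    _ ≤ 1 := by nlinarith [mul_nonneg (sq_nonneg u) (sub_nonneg.2 hu1), sq_nonneg u]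

/-- Let `β > 0` and `γ = 1/√(2β)`. If `(ε_t)` is a sequence of nonnegative
reals with `ε_0 ≤ γ/√2` and `ε_{t+1} ≤ ε_t − β·ε_t³` for every `t`, then for every `t`,
`ε_t ≤ γ/√(t+2)`. -/
theorem stmt11 (β : ℝ) (hβ : 0 < β) (γ : ℝ) (hγ : γ = 1 / Real.sqrt (2 * β))
    (ε : ℕ → ℝ) (hnn : ∀ t, 0 ≤ ε t) (h0 : ε 0 ≤ γ / Real.sqrt 2)
    (hrec : ∀ t, ε (t + 1) ≤ ε t - β * (ε t) ^ 3) :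
    ∀ t : ℕ, ε t ≤ γ / Real.sqrt ((t : ℝ) + 2) := by
  subst hγ
  have h2β : 0 < 2 * β := by positivity
  intro t
  rw [le_one_div_sqrt_div_sqrt_iff h2β (by positivity) (hnn t)]
  induction t with
  | zero =>
    rw [le_one_div_sqrt_div_sqrt_iff h2β two_pos (hnn 0)] at h0
    simpa using h0
  | succ t ih =>
    have ht : (0 : ℝ) ≤ t := t.cast_nonneg
    have := mul_sq_mul_add_one_le_one_of_le_sub_cube hβ (by linarith) (hnn (t + 1)) (hrec t) ih
    rwa [add_right_comm, ← Nat.cast_succ] at this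
end

section
/- Fix integers d, k ≥ 1 and real λ > 0. Encode the vertices of the (k+1)-uniform hypertree in which every vertex has d child-hyperedges each containing k children as finite lists over (Fin d × Fin k), with root the empty list and depth the list length. For ℓ ≥ 1 and an activity assignment λ⃗ assigning to each node v a real λ⃗(v) with 0 ≤ λ⃗(v) ≤ λ, define values in the extended nonnegative reals [0,∞] by downward recursion: nodes at depth ℓ get the boundary value, and a node v at depth m < ℓ gets R(v) = λ⃗(v) · ∏_{i∈Fin d} (1 + Σ_{j∈Fin k} R(v⌢(i,j)))⁻¹. Let R⁺_ℓ(λ⃗) be the root value with boundary value ∞ when ℓ is even and 0 when ℓ is odd, let R⁻_ℓ(λ⃗) be the root value with the opposite boundary, and let R⁺_ℓ, R⁻_ℓ denote these values for the constant assignment λ⃗ ≡ λ. Then for every ℓ ≥ 1 and every such λ⃗, both of the following cross-multiplied inequalities hold: R⁺_ℓ(λ⃗) · R⁻_ℓ ≤ R⁺_ℓ · R⁻_ℓ(λ⃗), and (1 + k·R⁺_ℓ(λ⃗)) · (1 + k·R⁻_ℓ) ≤ (1 + k·R⁺_ℓ) · (1 + k·R⁻_ℓ(λ⃗)). -/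
open scoped ENNReal

/-- Value (occupation ratio) at a node of the `(k+1)`-uniform `d`-ary hypertree, computed by
downward recursion in `ℝ≥0∞`.  Nodes are lists over `Fin d × Fin k` (root `= []`), `lam`
assigns each node its activity, `b` is the boundary value assigned at remaining depth `0`,
and `treeR d k lam b n v` is the value at node `v` when the boundary lies `n` levels below:
a node with remaining depth `n+1` gets
`lam v · ∏_{i} (1 + ∑_{j} value of child (i,j))⁻¹`. -/
noncomputable def treeR (d k : ℕ) (lam : List (Fin d × Fin k) → ℝ) (b : ℝ≥0∞) :
    ℕ → List (Fin d × Fin k) → ℝ≥0∞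
  | 0, _ => b
  | n + 1, v =>
      ENNReal.ofReal (lam v) *
        ∏ i : Fin d, (1 + ∑ j : Fin k, treeR d k lam b n (v ++ [(i, j)]))⁻¹

/-- Real occupation ratio with `n` levels below the node and boundary value `0`. -/
noncomputable def realR (d k : ℕ) (lam : List (Fin d × Fin k) → ℝ) :
    ℕ → List (Fin d × Fin k) → ℝ
  | 0, _ => 0
  | n + 1, v => lam v * ∏ i : Fin d, (1 + ∑ j : Fin k, realR d k lam n (v ++ [(i, j)]))⁻¹

lemma realR_nonneg {d k : ℕ} {lam : List (Fin d × Fin k) → ℝ} (h : ∀ v, 0 ≤ lam v) (n : ℕ)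
    (v : List (Fin d × Fin k)) : 0 ≤ realR d k lam n v := by
  induction n generalizing v with
  | zero => simp [realR]
  | succ n ih =>
    exact mul_nonneg (h v) (Finset.prod_nonneg fun i _ => inv_nonneg.2
      (add_nonneg zero_le_one (Finset.sum_nonneg fun j _ => ih _)))

lemma treeR_zero_eq_ofReal {d k : ℕ} {lam : List (Fin d × Fin k) → ℝ} (h : ∀ v, 0 ≤ lam v)
    (n : ℕ) (v : List (Fin d × Fin k)) :
    treeR d k lam 0 n v = ENNReal.ofReal (realR d k lam n v) := by
  induction n generalizing v with
  | zero => simp [treeR, realR]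
  | succ n ih =>
    have hs (i : Fin d) : 0 ≤ ∑ j : Fin k, realR d k lam n (v ++ [(i, j)]) :=
      Finset.sum_nonneg fun j _ => realR_nonneg h _ _
    have hp (i : Fin d) : 0 < 1 + ∑ j : Fin k, realR d k lam n (v ++ [(i, j)]) := by
      linarith [hs i]
    rw [treeR, realR, ENNReal.ofReal_mul (h v), ENNReal.ofReal_prod_of_nonneg
      (fun i _ => (inv_pos.2 (hp i)).le)]
    congr 1
    refine Finset.prod_congr rfl fun i _ => ?_
    rw [ENNReal.ofReal_inv_of_pos (hp i), ENNReal.ofReal_add zero_le_one (hs i),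
      ENNReal.ofReal_one, ENNReal.ofReal_sum_of_nonneg (fun j _ => realR_nonneg h _ _)]
    simp only [ih]

/-- Infinite boundary values force the value `0` one level above. -/
lemma treeR_top_succ {d k : ℕ} (hd : 1 ≤ d) (hk : 1 ≤ k) (lam : List (Fin d × Fin k) → ℝ)
    (n : ℕ) (v : List (Fin d × Fin k)) :
    treeR d k lam ⊤ (n + 1) v = treeR d k lam 0 n v := by
  induction n generalizing v with
  | zero =>
    have hk0 : k ≠ 0 := by omega
    have hd0 : d ≠ 0 := by omega
    simp [treeR, hk0, hd0, ENNReal.mul_top]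
  | succ n ih =>
    rw [treeR]
    simp only [ih]
    rw [treeR]

/-- The scalar recursion obeyed by `realR` for a constant activity. -/
lemma realR_const_succ {d k : ℕ} (lam : ℝ) (n : ℕ) (v w : List (Fin d × Fin k)) :
    realR d k (fun _ => lam) (n + 1) v =
      lam * ((1 + k * realR d k (fun _ => lam) n w)⁻¹) ^ d := by
  have hc (n : ℕ) (v w : List (Fin d × Fin k)) :
      realR d k (fun _ => lam) n v = realR d k (fun _ => lam) n w := by
    induction n generalizing v w with
    | zero => rfl
    | succ n ih => simp only [realR, fun i j => ih (v ++ [(i, j)]) (w ++ [(i, j)])]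
  simp only [realR, fun i j => hc n (v ++ [(i, j)]) w]
  simp

/-- One step of the scalar recursion is antitone. -/
lemma const_step_antitone {d k : ℕ} {lam x y : ℝ} (hlam : 0 ≤ lam) (hx : 0 ≤ x) (hxy : x ≤ y) :
    lam * ((1 + k * y)⁻¹) ^ d ≤ lam * ((1 + k * x)⁻¹) ^ d := by
  have : (0 : ℝ) ≤ k * x := by positivity
  have : (0 : ℝ) ≤ k * y := mul_nonneg (Nat.cast_nonneg _) (hx.trans hxy)
  gcongr

/-- The pair `(P, M)` has smaller ratio than `(p, m)`, also after applying `x ↦ 1 + k x`. -/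
def RatioDominated (k : ℕ) (P M p m : ℝ) : Prop :=
  P * m ≤ p * M ∧ (1 + k * P) * (1 + k * m) ≤ (1 + k * p) * (1 + k * M)

/-- A product form of Bernoulli's inequality: the product of the affine functions
`1 + (t / s) * s i` is controlled by a power of the product of the `1 + s i`. -/
lemma prod_inv_lower_bound {d : ℕ} {s t : ℝ} {S T : Fin d → ℝ} (hs : 0 < s) (hst : s ≤ t)
    (hS : ∀ i, 0 ≤ S i) (hT : ∀ i, 0 ≤ T i) (h : ∀ i, T i * s ≤ t * S i) :
    ((1 + t)⁻¹) ^ d * ((∏ i, (1 + S i)⁻¹) / ((1 + s)⁻¹) ^ d) ^ (t * (1 + s) / (s * (1 + t))) ≤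
      ∏ i, (1 + T i)⁻¹ := by
  have ht : 0 < t := hs.trans_le hst
  set α := t * (1 + s) / (s * (1 + t)) with hα
  have hα1 : 1 ≤ α := by
    rw [hα, one_le_div (by positivity)]
    nlinarith
  have hX (i : Fin d) : 0 < 1 + S i := by linarith [hS i]
  have hY (i : Fin d) : 0 < 1 + T i := by linarith [hT i]
  have key (i : Fin d) : (1 + t)⁻¹ * ((1 + S i)⁻¹ / (1 + s)⁻¹) ^ α ≤ (1 + T i)⁻¹ := by
    have hw : 0 < (1 + S i) / (1 + s) := div_pos (hX i) (by positivity)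
    have hb := one_add_mul_self_le_rpow_one_add (s := (1 + S i) / (1 + s) - 1)
      (by linarith) hα1
    rw [add_sub_cancel] at hb
    have hTi : 1 + T i ≤ (1 + t) * ((1 + S i) / (1 + s)) ^ α := by
      calc 1 + T i ≤ 1 + t * S i / s := by
            have := (le_div_iff₀ hs).2 (h i)
            linarith
        _ = (1 + t) * (1 + α * ((1 + S i) / (1 + s) - 1)) := by
            rw [hα]; field_simp; ring
        _ ≤ _ := by gcongr
    have hinv : (1 + S i)⁻¹ / (1 + s)⁻¹ = ((1 + S i) / (1 + s))⁻¹ := by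
      rw [inv_div_inv, inv_div]
    rw [hinv, Real.inv_rpow hw.le, ← mul_inv]
    exact inv_anti₀ (hY i) hTi
  have hprod : ((1 + t)⁻¹) ^ d * ((∏ i, (1 + S i)⁻¹) / ((1 + s)⁻¹) ^ d) ^ α =
      ∏ i : Fin d, ((1 + t)⁻¹ * ((1 + S i)⁻¹ / (1 + s)⁻¹) ^ α) := by
    rw [Finset.prod_mul_distrib, Real.finsetProd_rpow _ _
      (fun i _ => div_nonneg (inv_pos.2 (hX i)).le (by positivity)), Finset.prod_div_distrib]
    simp
  rw [hprod]
  exact Finset.prod_le_prod (fun i _ => by have := hX i; positivity) fun i _ => key i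

/-- If `P / p ≥ 1` and `M / m` is at least the `α`-th power of it, then Bernoulli's inequality
gives the bound on `(1 + P) / (1 + M)`. -/
lemma one_add_mul_le_of_rpow {a b w α : ℝ} (ha : 0 ≤ a) (hb : 0 ≤ b) (hw : 1 ≤ w) (hα : 1 ≤ α)
    (h : a * (1 + b) ≤ α * (b * (1 + a))) :
    (1 + a * w) * (1 + b) ≤ (1 + a) * (1 + b * w ^ α) := by
  have hbern := one_add_mul_self_le_rpow_one_add (s := w - 1) (by linarith) hα
  rw [add_sub_cancel] at hbern
  calc (1 + a * w) * (1 + b) ≤ (1 + a) * (1 + b * (1 + α * (w - 1))) := by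
        nlinarith [mul_le_mul_of_nonneg_right h (sub_nonneg.2 hw)]
    _ ≤ _ := by gcongr

/-- The domination of ratios propagates from the children to the parent. -/
lemma RatioDominated.step {d k : ℕ} (hk : 1 ≤ k) {lam mu p m p' m' : ℝ}
    {P' M' : Fin d → Fin k → ℝ} (hlam : 0 < lam) (hmu : 0 ≤ mu) (hmulam : mu ≤ lam)
    (hP' : ∀ i j, 0 ≤ P' i j) (hM' : ∀ i j, 0 ≤ M' i j) (hm' : 0 ≤ m') (hmp' : m' ≤ p')
    (hp : p = lam * ((1 + k * m')⁻¹) ^ d) (hm : m = lam * ((1 + k * p')⁻¹) ^ d)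
    (hpar : p = p' ∧ m' ≤ m ∨ m = m' ∧ p ≤ p')
    (h : ∀ i j, RatioDominated k (P' i j) (M' i j) p' m') :
    RatioDominated k (mu * ∏ i, (1 + ∑ j, M' i j)⁻¹) (mu * ∏ i, (1 + ∑ j, P' i j)⁻¹) p m := by
  have hk0 : (0 : ℝ) < k := by exact_mod_cast hk
  have hS (i : Fin d) : 0 ≤ ∑ j, M' i j := Finset.sum_nonneg fun j _ => hM' i j
  have hT (i : Fin d) : 0 ≤ ∑ j, P' i j := Finset.sum_nonneg fun j _ => hP' i j
  have hS1 (i : Fin d) : 0 < 1 + ∑ j, M' i j := by linarith [hS i]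
  have hT1 (i : Fin d) : 0 < 1 + ∑ j, P' i j := by linarith [hT i]
  have hp'0 : 0 ≤ p' := hm'.trans hmp'
  have hmp : m ≤ p := by
    rw [hp, hm]
    exact const_step_antitone hlam.le hm' hmp'
  have hsum (i : Fin d) :
      (1 + ∑ j, P' i j) * (1 + k * m') ≤ (1 + k * p') * (1 + ∑ j, M' i j) := by
    have := Finset.sum_le_sum (s := Finset.univ) fun j _ => (h i j).2
    simp only [← Finset.sum_mul, ← Finset.mul_sum, Finset.sum_add_distrib, Finset.sum_const,
      Finset.card_univ, Fintype.card_fin, nsmul_eq_mul, mul_one] at this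
    refine le_of_mul_le_mul_left ?_ hk0
    linarith
  have hratio (i : Fin d) : (∑ j, P' i j) * (k * m') ≤ k * p' * ∑ j, M' i j := by
    have := Finset.sum_le_sum (s := Finset.univ) fun j _ => (h i j).1
    rw [← Finset.sum_mul, ← Finset.mul_sum] at this
    nlinarith
  set A := ∏ i, (1 + ∑ j, M' i j)⁻¹ with hA
  set B := ∏ i, (1 + ∑ j, P' i j)⁻¹ with hB
  have hA0 : 0 < A := Finset.prod_pos fun i _ => inv_pos.2 (hS1 i)
  have hB0 : 0 < B := Finset.prod_pos fun i _ => inv_pos.2 (hT1 i)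
  set a := ((1 + k * m')⁻¹) ^ d with ha
  set b := ((1 + k * p')⁻¹) ^ d with hb
  have ha0 : 0 < a := by positivity
  have hb0 : 0 < b := by positivity
  have hp0 : 0 < p := by rw [hp]; positivity
  have hm0 : 0 < m := by rw [hm]; positivity
  have hAB : A * b ≤ a * B := by
    have hc (c : ℝ) : c ^ d = ∏ _i : Fin d, c := by simp
    rw [ha, hb, hA, hB, hc, hc, ← Finset.prod_mul_distrib, ← Finset.prod_mul_distrib]
    refine Finset.prod_le_prod (fun i _ => by have := hS1 i; positivity) fun i _ => ?_
    rw [← mul_inv, ← mul_inv]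
    refine inv_anti₀ (mul_pos (by positivity) (hT1 i)) ?_
    linarith [hsum i]
  have hfull : (1 + k * (lam * A)) * (1 + k * m) ≤ (1 + k * p) * (1 + k * (lam * B)) := by
    set w := A / a with hw
    have hAw : A = a * w := by rw [hw]; field_simp
    have hPw : k * (lam * A) = k * p * w := by rw [hp, hAw]; ring
    rw [hPw]
    rcases le_total w 1 with hw1 | hw1
    · have hBw : b * w ≤ B := by
        rw [hAw] at hAB
        exact le_of_mul_le_mul_left (by linarith) ha0
      have hMw : k * m * w ≤ k * (lam * B) := by
        rw [hm]
        calc k * (lam * b) * w = k * lam * (b * w) := by ring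
          _ ≤ k * lam * B := by gcongr
          _ = _ := by ring
      calc (1 + k * p * w) * (1 + k * m) ≤ (1 + k * p) * (1 + k * m * w) := by
            nlinarith [mul_nonneg (mul_nonneg hk0.le (sub_nonneg.2 hmp)) (sub_nonneg.2 hw1)]
        _ ≤ _ := by gcongr
    · rcases hm'.eq_or_lt with hm'0 | hm'0
      · have ha1 : a = 1 := by rw [ha, ← hm'0]; simp
        have hA1 : A ≤ 1 := Finset.prod_le_one (fun i _ => (inv_pos.2 (hS1 i)).le)
          fun i _ => inv_le_one_of_one_le₀ (by linarith [hS i])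
        have hweq : w = 1 := le_antisymm (by rw [hw, ha1, div_one]; exact hA1) hw1
        have hbB : b ≤ B := by
          have : A = 1 := by rw [hAw, hweq, ha1, one_mul]
          rwa [this, ha1, one_mul, one_mul] at hAB
        rw [hweq, mul_one, hm]
        gcongr
      · have hs : 0 < k * m' := mul_pos hk0 hm'0
        have hst : k * m' ≤ k * p' := by gcongr
        have hp'pos : 0 < p' := hm'0.trans_le hmp'
        have hlow := prod_inv_lower_bound hs hst hS hT hratio
        have hα : 1 ≤ k * p' * (1 + k * m') / (k * m' * (1 + k * p')) := by
          rw [one_le_div (by positivity)]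
          nlinarith
        have hcond : k * p * (1 + k * m) ≤
            k * p' * (1 + k * m') / (k * m' * (1 + k * p')) * (k * m * (1 + k * p)) := by
          rw [div_mul_eq_mul_div, le_div_iff₀ (by positivity)]
          rcases hpar with ⟨rfl, hmm⟩ | ⟨rfl, hpp⟩
          · have : k * m' * (1 + k * m) ≤ k * m * (1 + k * m') := by nlinarith
            nlinarith [mul_le_mul_of_nonneg_left this
              (show 0 ≤ k * p * (1 + k * p) by positivity)]
          · have : k * p * (1 + k * p') ≤ k * p' * (1 + k * p) := by nlinarith
            nlinarith [mul_le_mul_of_nonneg_left this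
              (show 0 ≤ k * m * (1 + k * m) by positivity)]
        refine (one_add_mul_le_of_rpow (by positivity) (by positivity) hw1 hα hcond).trans ?_
        have hMw : k * m * w ^ (k * p' * (1 + k * m') / (k * m' * (1 + k * p'))) ≤
            k * (lam * B) := by
          rw [hm, mul_assoc, mul_assoc]
          gcongr
        gcongr
  refine ⟨?_, ?_⟩
  · rw [hp, hm]
    nlinarith [mul_le_mul_of_nonneg_left hAB (mul_nonneg hmu hlam.le)]
  · refine le_of_mul_le_mul_left ?_ hlam
    have hz : (lam - mu) * (1 + k * m) ≤ (lam - mu) * (1 + k * p) :=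
      mul_le_mul_of_nonneg_left (by gcongr) (sub_nonneg.2 hmulam)
    have hf := mul_le_mul_of_nonneg_left hfull hmu
    linarith

lemma realR_const_alternating {d k : ℕ} {lam : ℝ} (hlam : 0 ≤ lam) (n : ℕ)
    (v : List (Fin d × Fin k)) :
    let c := fun n => realR d k (fun _ => lam) n v
    (c (2 * n) ≤ c (2 * n + 2) ∧ c (2 * n + 2) ≤ c (2 * n + 1)) ∧
      c (2 * n + 2) ≤ c (2 * n + 3) ∧ c (2 * n + 3) ≤ c (2 * n + 1) := by
  intro c
  have h0 (n : ℕ) : 0 ≤ c n := realR_nonneg (fun _ => hlam) n v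
  have anti {i j : ℕ} (h : c i ≤ c j) : c (j + 1) ≤ c (i + 1) := by
    simp only [c, realR_const_succ lam _ v v]
    exact const_step_antitone hlam (h0 i) h
  have hle (n : ℕ) (h : c (2 * n) ≤ c (2 * n + 1)) (h' : c (2 * n) ≤ c (2 * n + 2)) :
      (c (2 * n) ≤ c (2 * n + 2) ∧ c (2 * n + 2) ≤ c (2 * n + 1)) ∧
        c (2 * n + 2) ≤ c (2 * n + 3) ∧ c (2 * n + 3) ≤ c (2 * n + 1) :=
    ⟨⟨h', anti h⟩, anti (anti h), anti h'⟩
  induction n with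
  | zero => exact hle 0 (h0 1) (h0 2)
  | succ n ih =>
    obtain ⟨⟨h1, h2⟩, h3, h4⟩ := ih
    exact hle (n + 1) h3 (anti h4)

lemma realR_ratioDominated {d k : ℕ} (hk : 1 ≤ k) {lam : ℝ} (hlam : 0 < lam)
    {lamv : List (Fin d × Fin k) → ℝ} (hlamv : ∀ v, 0 ≤ lamv v ∧ lamv v ≤ lam) (n : ℕ) :
    let r := realR d k lamv
    let c := fun n => realR d k (fun _ => lam) n []
    (∀ v, RatioDominated k (r (2 * n + 1) v) (r (2 * n) v) (c (2 * n + 1)) (c (2 * n))) ∧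
      ∀ v, RatioDominated k (r (2 * n + 1) v) (r (2 * n + 2) v)
        (c (2 * n + 1)) (c (2 * n + 2)) := by
  intro r c
  have hr (n : ℕ) (v) : 0 ≤ r n v := realR_nonneg (fun v => (hlamv v).1) n v
  have hc (n : ℕ) : 0 ≤ c n := realR_nonneg (fun _ => hlam.le) n []
  have hsucc (n : ℕ) : c (n + 1) = lam * ((1 + k * c n)⁻¹) ^ d := realR_const_succ lam n [] []
  have alt (n : ℕ) := realR_const_alternating (d := d) (k := k) hlam.le n []
  have second (n : ℕ) (h : ∀ v, RatioDominated k (r (2 * n + 1) v) (r (2 * n) v)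
      (c (2 * n + 1)) (c (2 * n))) (v) :
      RatioDominated k (r (2 * n + 1) v) (r (2 * n + 2) v) (c (2 * n + 1)) (c (2 * n + 2)) :=
    RatioDominated.step hk hlam (hlamv v).1 (hlamv v).2 (fun i j => hr _ _) (fun i j => hr _ _)
      (hc _) ((alt n).1.1.trans (alt n).1.2) (hsucc _) (hsucc _) (.inl ⟨rfl, (alt n).1.1⟩)
      fun i j => h _
  induction n with
  | zero =>
    have base (v) : RatioDominated k (r 1 v) (r 0 v) (c 1) (c 0) := by
      have : lamv v ≤ lam := (hlamv v).2
      simp only [RatioDominated, r, c, realR]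
      simp only [Finset.sum_const_zero, add_zero, inv_one, Finset.prod_const_one, mul_one,
        mul_zero, le_refl, true_and]
      gcongr
    exact ⟨base, second 0 base⟩
  | succ n ih =>
    have first (v) : RatioDominated k (r (2 * (n + 1) + 1) v) (r (2 * (n + 1)) v)
        (c (2 * (n + 1) + 1)) (c (2 * (n + 1))) :=
      RatioDominated.step hk hlam (hlamv v).1 (hlamv v).2 (fun i j => hr _ _)
        (fun i j => hr _ _) (hc _) (alt n).1.2 (hsucc _) (hsucc _)
        (.inr ⟨rfl, (alt n).2.2⟩) fun i j => ih.2 _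
    exact ⟨first, second (n + 1) first⟩

lemma RatioDominated.ofReal {k : ℕ} {P M p m : ℝ} (hP : 0 ≤ P) (hM : 0 ≤ M) (hp : 0 ≤ p)
    (hm : 0 ≤ m) (h : RatioDominated k P M p m) :
    ENNReal.ofReal P * ENNReal.ofReal m ≤ ENNReal.ofReal p * ENNReal.ofReal M ∧
      (1 + (k : ℝ≥0∞) * ENNReal.ofReal P) * (1 + (k : ℝ≥0∞) * ENNReal.ofReal m) ≤
        (1 + (k : ℝ≥0∞) * ENNReal.ofReal p) * (1 + (k : ℝ≥0∞) * ENNReal.ofReal M) := by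
  have hcast {x : ℝ} (hx : 0 ≤ x) :
      1 + (k : ℝ≥0∞) * ENNReal.ofReal x = ENNReal.ofReal (1 + k * x) := by
    rw [ENNReal.ofReal_add zero_le_one (by positivity), ENNReal.ofReal_mul (by positivity)]
    simp
  rw [hcast hP, hcast hM, hcast hp, hcast hm, ← ENNReal.ofReal_mul hP, ← ENNReal.ofReal_mul hp,
    ← ENNReal.ofReal_mul (by positivity), ← ENNReal.ofReal_mul (by positivity)]
  exact ⟨ENNReal.ofReal_le_ofReal h.1, ENNReal.ofReal_le_ofReal h.2⟩

/-- for every `ℓ ≥ 1` and every activity assignment `λ⃗` with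
`0 ≤ λ⃗(v) ≤ λ`, with `R⁺_ℓ(λ⃗)` (boundary `∞` for even `ℓ`, `0` for odd `ℓ`) and
`R⁻_ℓ(λ⃗)` (opposite boundary) the extremal root values, the cross-multiplied inequalities
`R⁺_ℓ(λ⃗)·R⁻_ℓ ≤ R⁺_ℓ·R⁻_ℓ(λ⃗)` and
`(1+k·R⁺_ℓ(λ⃗))·(1+k·R⁻_ℓ) ≤ (1+k·R⁺_ℓ)·(1+k·R⁻_ℓ(λ⃗))` hold, where `R⁺_ℓ, R⁻_ℓ` are the
values for the constant assignment `λ⃗ ≡ λ`. -/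
theorem stmt12 (d k : ℕ) (hd : 1 ≤ d) (hk : 1 ≤ k) (lam : ℝ) (hlam : 0 < lam)
    (lamv : List (Fin d × Fin k) → ℝ)
    (hlamv : ∀ v, 0 ≤ lamv v ∧ lamv v ≤ lam)
    (ℓ : ℕ) (hℓ : 1 ≤ ℓ) :
    treeR d k lamv (if Even ℓ then ⊤ else 0) ℓ [] *
        treeR d k (fun _ => lam) (if Even ℓ then 0 else ⊤) ℓ [] ≤
      treeR d k (fun _ => lam) (if Even ℓ then ⊤ else 0) ℓ [] *
        treeR d k lamv (if Even ℓ then 0 else ⊤) ℓ [] ∧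
    (1 + (k : ℝ≥0∞) * treeR d k lamv (if Even ℓ then ⊤ else 0) ℓ []) *
        (1 + (k : ℝ≥0∞) * treeR d k (fun _ => lam) (if Even ℓ then 0 else ⊤) ℓ []) ≤
      (1 + (k : ℝ≥0∞) * treeR d k (fun _ => lam) (if Even ℓ then ⊤ else 0) ℓ []) *
        (1 + (k : ℝ≥0∞) * treeR d k lamv (if Even ℓ then 0 else ⊤) ℓ []) := by
  have h0 (v) : 0 ≤ lamv v := (hlamv v).1
  have hc0 (v : List (Fin d × Fin k)) : 0 ≤ (fun _ => lam) v := hlam.le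
  obtain ⟨l, rfl⟩ := Nat.exists_eq_add_of_le' hℓ
  obtain ⟨n, rfl | rfl⟩ := Nat.even_or_odd' l
  · have hodd : ¬ Even (2 * n + 1) := by simp
    simp only [if_neg hodd, treeR_top_succ hd hk, treeR_zero_eq_ofReal h0,
      treeR_zero_eq_ofReal hc0]
    exact ((realR_ratioDominated hk hlam hlamv n).1 []).ofReal (realR_nonneg h0 _ _)
      (realR_nonneg h0 _ _) (realR_nonneg hc0 _ _) (realR_nonneg hc0 _ _)
  · have heven : Even (2 * n + 1 + 1) := ⟨n + 1, by ring⟩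
    simp only [if_pos heven, treeR_top_succ hd hk, treeR_zero_eq_ofReal h0,
      treeR_zero_eq_ofReal hc0]
    exact ((realR_ratioDominated hk hlam hlamv n).2 []).ofReal (realR_nonneg h0 _ _)
      (realR_nonneg h0 _ _) (realR_nonneg hc0 _ _) (realR_nonneg hc0 _ _)
end

section
/- Let d, k ≥ 1 be integers and λ > 0 a real. Suppose p₊, p₋ ∈ (0,1) satisfy 1 − k·p₊ − p₋ > 0 and 1 − p₊ − k·p₋ > 0, together with the two equations p₊·(1−p₊)^d = λ·(1 − k·p₊ − p₋)·(1 − p₊ − k·p₋)^d and p₋·(1−p₋)^d = λ·(1 − k·p₋ − p₊)·(1 − p₋ − k·p₊)^d. Then the quantities x = k·p₊/(1 − p₋ − k·p₊) and y = k·p₋/(1 − p₊ − k·p₋) are positive and satisfy y = kλ/(1+x)^d and x = kλ/(1+y)^d. -/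
/-- Solving the consistency equation `q (1 - q)^d = lam B (1 - q - a)^d` for `q / B`. -/
lemma div_eq_of_consistency {d : ℕ} {c lam a q B : ℝ} (hq : q < 1) (hA : 0 < 1 - q - a)
    (hB : 0 < B) (e : q * (1 - q) ^ d = lam * B * (1 - q - a) ^ d) :
    c * q / B = c * lam / (1 + a / (1 - q - a)) ^ d := by
  have h : 1 + a / (1 - q - a) = (1 - q) / (1 - q - a) := by
    rw [eq_div_iff hA.ne', add_mul, div_mul_cancel₀ _ hA.ne']
    ring
  have hq' : 0 < (1 - q) ^ d := pow_pos (sub_pos.2 hq) d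
  have hA' : 0 < (1 - q - a) ^ d := pow_pos hA d
  rw [h, div_pow, div_div_eq_mul_div, div_eq_div_iff hB.ne' hq'.ne']
  linear_combination c * e

/-- if `p₊, p₋ ∈ (0,1)` satisfy `1 − k·p₊ − p₋ > 0`, `1 − p₊ − k·p₋ > 0` and
the two consistency equations
`p₊(1−p₊)^d = λ(1 − k·p₊ − p₋)(1 − p₊ − k·p₋)^d` and
`p₋(1−p₋)^d = λ(1 − k·p₋ − p₊)(1 − p₋ − k·p₊)^d`,
then `x = k·p₊/(1 − p₋ − k·p₊)` and `y = k·p₋/(1 − p₊ − k·p₋)` are positive and satisfy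
`y = kλ/(1+x)^d` and `x = kλ/(1+y)^d`. -/
theorem stmt14 (d k : ℕ) (hd : 1 ≤ d) (hk : 1 ≤ k) (lam : ℝ) (hlam : 0 < lam)
    (pp pm : ℝ) (hpp0 : 0 < pp) (hpp1 : pp < 1) (hpm0 : 0 < pm) (hpm1 : pm < 1)
    (h1 : 0 < 1 - (k : ℝ) * pp - pm) (h2 : 0 < 1 - pp - (k : ℝ) * pm)
    (e1 : pp * (1 - pp) ^ d =
      lam * (1 - (k : ℝ) * pp - pm) * (1 - pp - (k : ℝ) * pm) ^ d)
    (e2 : pm * (1 - pm) ^ d =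
      lam * (1 - (k : ℝ) * pm - pp) * (1 - pm - (k : ℝ) * pp) ^ d) :
    0 < (k : ℝ) * pp / (1 - pm - (k : ℝ) * pp) ∧
    0 < (k : ℝ) * pm / (1 - pp - (k : ℝ) * pm) ∧
    (k : ℝ) * pm / (1 - pp - (k : ℝ) * pm) =
      (k : ℝ) * lam / (1 + (k : ℝ) * pp / (1 - pm - (k : ℝ) * pp)) ^ d ∧
    (k : ℝ) * pp / (1 - pm - (k : ℝ) * pp) =
      (k : ℝ) * lam / (1 + (k : ℝ) * pm / (1 - pp - (k : ℝ) * pm)) ^ d := by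
  have hk' : (0 : ℝ) < k := by exact_mod_cast hk
  rw [sub_right_comm] at h1 e1
  rw [sub_right_comm 1 ((k : ℝ) * pm) pp] at e2
  exact ⟨div_pos (mul_pos hk' hpp0) h1, div_pos (mul_pos hk' hpm0) h2,
    div_eq_of_consistency hpm1 h1 h2 e2, div_eq_of_consistency hpp1 h2 h1 e1⟩
end

section
/- Let V be a finite type, G a simple graph on V in which every vertex has at least one neighbor, t ≥ 1 an integer, and λ ≥ 0 a real. Call a finite subset S ⊆ V × Fin t blow-up-independent if for every edge {u, v} of G, S contains at most one element of {u, v} × Fin t. Then Σ over all blow-up-independent S of λ^{|S|} equals Σ over all independent sets I of G of (t·λ)^{|I|}. (Here I ⊆ V is independent in G if no two elements of I are adjacent.) -/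
open Finset

/-- The graphs of functions `I → W` are the subsets of `V × W` that project injectively onto `I`. -/
lemma card_filter_injOn_fst_image_fst_eq {V W : Type*} [Fintype V] [Fintype W]
    [DecidableEq V] [DecidableEq W] (I : Finset V) :
    (univ.filter (fun S : Finset (V × W) =>
      Set.InjOn Prod.fst (S : Set (V × W)) ∧ S.image Prod.fst = I)).card =
      Fintype.card W ^ I.card := by
  have h_pi : (I.pi (fun _ => (univ : Finset W))).card = Fintype.card W ^ I.card := by
    simp [Finset.card_pi]
  rw [← h_pi]
  symm
  refine Finset.card_bij (fun f _ => I.attach.image (fun v => (v.1, f v.1 v.2))) ?_ ?_ ?_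
  · intro f _
    simp only [mem_filter, mem_univ, true_and]
    constructor
    · intro p hp q hq hpq
      simp only [coe_image, Set.mem_image, mem_coe, mem_attach, true_and] at hp hq
      obtain ⟨⟨a, ha⟩, rfl⟩ := hp
      obtain ⟨⟨b, hb⟩, rfl⟩ := hq
      obtain rfl : a = b := hpq
      rfl
    · ext v
      simp
  · intro f _ g _ hfg
    funext v hv
    have h_mem : (v, f v hv) ∈ I.attach.image (fun v => (v.1, g v.1 v.2)) := by
      rw [← hfg]
      exact mem_image.2 ⟨⟨v, hv⟩, mem_attach _ _, rfl⟩
    obtain ⟨⟨a, ha⟩, -, h_eq⟩ := mem_image.1 h_mem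
    obtain ⟨rfl, h⟩ := Prod.mk.inj h_eq
    exact h.symm
  · intro S hS
    obtain ⟨-, h_inj, rfl⟩ := mem_filter.1 hS
    have h_ex : ∀ v ∈ S.image Prod.fst, ∃ w, (v, w) ∈ S := by simp
    choose f hf using h_ex
    refine ⟨f, by simp, ?_⟩
    ext ⟨v, w⟩
    constructor
    · intro h
      obtain ⟨⟨a, ha⟩, -, h_eq⟩ := mem_image.1 h
      exact h_eq ▸ hf a ha
    · intro h
      have hv : v ∈ S.image Prod.fst := mem_image_of_mem Prod.fst h
      refine mem_image.2 ⟨⟨v, hv⟩, mem_attach _ _, ?_⟩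
      exact h_inj (hf v hv) h rfl

/-- In a graph without isolated vertices, a set meets every blown-up edge at most once iff it
projects injectively onto an independent set. -/
lemma forall_adj_card_filter_le_one_iff {V W : Type*} [DecidableEq V]
    {G : SimpleGraph V} (hG : ∀ v : V, ∃ u : V, G.Adj v u) (S : Finset (V × W)) :
    (∀ u v : V, G.Adj u v → (S.filter (fun p => p.1 = u ∨ p.1 = v)).card ≤ 1) ↔
      Set.InjOn Prod.fst (S : Set (V × W)) ∧
        ∀ u ∈ S.image Prod.fst, ∀ v ∈ S.image Prod.fst, ¬ G.Adj u v := by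
  simp only [card_le_one, mem_filter, mem_image]
  constructor
  · intro h
    refine ⟨fun p hp q hq hpq => ?_, ?_⟩
    · obtain ⟨u, hu⟩ := hG p.1
      exact h _ _ hu p ⟨hp, .inl rfl⟩ q ⟨hq, .inl hpq.symm⟩
    · rintro _ ⟨p, hp, rfl⟩ _ ⟨q, hq, rfl⟩ h_adj
      exact h_adj.ne (congrArg Prod.fst (h _ _ h_adj p ⟨hp, .inl rfl⟩ q ⟨hq, .inr rfl⟩))
  · rintro ⟨h_inj, h_ind⟩ u v h_adj p ⟨hp, hpu⟩ q ⟨hq, hqu⟩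
    apply h_inj hp hq
    have h_pq := h_ind _ ⟨p, hp, rfl⟩ _ ⟨q, hq, rfl⟩
    have h_qp := h_ind _ ⟨q, hq, rfl⟩ _ ⟨p, hp, rfl⟩
    rcases hpu with rfl | rfl <;> rcases hqu with h | h
    · exact h.symm
    · exact absurd (h ▸ h_adj) h_pq
    · exact absurd (h ▸ h_adj) h_qp
    · exact h.symm

/-- let `G` be a finite simple graph in which every vertex has a neighbor,
`t ≥ 1` and `λ ≥ 0`.  Call `S ⊆ V × Fin t` blow-up-independent if for every edge `{u,v}` of
`G`, `S` contains at most one element of `{u,v} × Fin t`.  Then the sum of `λ^|S|` over all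
blow-up-independent `S` equals the sum of `(t·λ)^|I|` over all independent sets `I` of `G`. -/
theorem stmt18 {V : Type*} [Fintype V] [DecidableEq V]
    (G : SimpleGraph V) [DecidableRel G.Adj]
    (hG : ∀ v : V, ∃ u : V, G.Adj v u)
    (t : ℕ) (ht : 1 ≤ t) (lam : ℝ) (hlam : 0 ≤ lam) :
    ∑ S ∈ univ.filter (fun S : Finset (V × Fin t) =>
        ∀ u v : V, G.Adj u v → (S.filter (fun p => p.1 = u ∨ p.1 = v)).card ≤ 1),
      lam ^ S.card =
    ∑ I ∈ univ.filter (fun I : Finset V => ∀ u ∈ I, ∀ v ∈ I, ¬ G.Adj u v),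
      ((t : ℝ) * lam) ^ I.card := by
  simp only [forall_adj_card_filter_le_one_iff hG]
  rw [← Finset.sum_fiberwise_of_maps_to (g := fun S : Finset (V × Fin t) => S.image Prod.fst)
    (t := univ.filter (fun I : Finset V => ∀ u ∈ I, ∀ v ∈ I, ¬ G.Adj u v))
    (fun S hS => mem_filter.2 ⟨mem_univ _, (mem_filter.1 hS).2.2⟩)]
  refine Finset.sum_congr rfl fun I hI => ?_
  have h_ind := (mem_filter.1 hI).2
  have h_fiber := card_filter_injOn_fst_image_fst_eq (W := Fin t) I
  rw [Fintype.card_fin] at h_fiber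
  rw [filter_filter, mul_pow, ← Nat.cast_pow, ← h_fiber, ← nsmul_eq_mul]
  rw [← Finset.sum_const]
  refine Finset.sum_congr ?_ fun S hS => ?_
  · ext S
    simp only [mem_filter, mem_univ, true_and]
    constructor
    · rintro ⟨⟨h_inj, -⟩, h⟩
      exact ⟨h_inj, h⟩
    · rintro ⟨h_inj, h⟩
      exact ⟨⟨h_inj, h.symm ▸ h_ind⟩, h⟩
  · obtain ⟨-, h_inj, h⟩ := mem_filter.1 hS
    rw [← h, card_image_of_injOn h_inj]
end
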